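/- arXiv:2505.15126 — 4 statements merged into one kernel-verified Lean document; each statement's English description precedes it below -/
import Mathlib

section
/- Let N ≥ 3 be an integer and λ_N := (N−2)²/4. Then for every Schwartz function f : ℝ^N → ℂ one has the sharp Hardy inequality λ_N ∫_{ℝ^N} |x|^{-2} |f(x)|² dx ≤ ∫_{ℝ^N} |∇f(x)|² dx. -/
open MeasureTheory

/-- Squared Euclidean length of the gradient of a complex-valued function on `ℝ^N`:
`|∇f(x)|² = ∑ i ‖∂ᵢ f(x)‖²`. -/
noncomputable def gradSq {N : ℕ} (f : EuclideanSpace ℝ (Fin N) → ℂ)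
    (x : EuclideanSpace ℝ (Fin N)) : ℝ :=
  ∑ i, ‖fderiv ℝ f x (EuclideanSpace.single i 1)‖ ^ 2

open Filter Topology SchwartzMap

section Schwartz

variable {E F : Type*} [NormedAddCommGroup E] [InnerProductSpace ℝ E] [FiniteDimensional ℝ E]
  [MeasurableSpace E] [BorelSpace E] [NormedAddCommGroup F] [InnerProductSpace ℝ F]

theorem SchwartzMap.integrable_norm_sq (f : 𝓢(E, F)) : Integrable (fun x ↦ ‖f x‖ ^ 2) :=
  (f.memLp 2).norm.integrable_sq

theorem SchwartzMap.integrable_norm_fderiv_sq (f : 𝓢(E, F)) (v : E) :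
    Integrable (fun x ↦ ‖fderiv ℝ f x v‖ ^ 2) :=
  (LineDeriv.lineDerivOp v f : 𝓢(E, F)).integrable_norm_sq

theorem SchwartzMap.integrable_inner_fderiv (f : 𝓢(E, F)) (v : E) :
    Integrable (fun x ↦ 2 * inner ℝ (f x) (fderiv ℝ f x v)) := by
  have hcont : Continuous (fun x ↦ fderiv ℝ f x v) :=
    (LineDeriv.lineDerivOp v f : 𝓢(E, F)).continuous
  refine (f.integrable_norm_sq.add (f.integrable_norm_fderiv_sq v)).mono'
    (by have := f.continuous; fun_prop) (.of_forall fun x ↦ ?_)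
  have h := norm_inner_le_norm (𝕜 := ℝ) (f x) (fderiv ℝ f x v)
  rw [norm_mul, Real.norm_ofNat, Pi.add_apply]
  nlinarith [sq_nonneg (‖f x‖ - ‖fderiv ℝ f x v‖)]

/-- A one-directional Hardy-type inequality: completing the square with the multiplier `φ`. -/
theorem SchwartzMap.integral_sub_sq_mul_norm_sq_le (f : 𝓢(E, F)) (v : E) {φ ψ : E → ℝ}
    (hφ : Continuous φ) (hψ : Continuous ψ) {C : ℝ} (hφC : ∀ x, |φ x| ≤ C)
    (hψC : ∀ x, |ψ x| ≤ C) (hderiv : ∀ x, HasLineDerivAt ℝ φ (ψ x) x v) :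
    Integrable (fun x ↦ (ψ x - φ x ^ 2) * ‖f x‖ ^ 2) ∧
      ∫ x, (ψ x - φ x ^ 2) * ‖f x‖ ^ 2 ≤ ∫ x, ‖fderiv ℝ f x v‖ ^ 2 := by
  have hψf : Integrable (fun x ↦ ψ x * ‖f x‖ ^ 2) :=
    f.integrable_norm_sq.bdd_mul hψ.aestronglyMeasurable (.of_forall hψC)
  have hφf : Integrable (fun x ↦ φ x * ‖f x‖ ^ 2) :=
    f.integrable_norm_sq.bdd_mul hφ.aestronglyMeasurable (.of_forall hφC)
  have hφφf : Integrable (fun x ↦ φ x ^ 2 * ‖f x‖ ^ 2) := by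
    refine (hφf.bdd_mul hφ.aestronglyMeasurable (.of_forall hφC)).congr (.of_forall fun x ↦ ?_)
    simp only; ring
  have hφf' : Integrable (fun x ↦ φ x * (2 * inner ℝ (f x) (fderiv ℝ f x v))) :=
    (f.integrable_inner_fderiv v).bdd_mul hφ.aestronglyMeasurable (.of_forall hφC)
  have hparts : ∫ x, φ x * (2 * inner ℝ (f x) (fderiv ℝ f x v)) = - ∫ x, ψ x * ‖f x‖ ^ 2 :=
    integral_bilinear_hasLineDerivAt_right_eq_neg_left_of_integrable
      (B := ContinuousLinearMap.mul ℝ ℝ) hψf hφf' hφf (fun x _ ↦ hderiv x)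
      (fun x _ ↦ by simpa using (f.hasFDerivAt x).norm_sq.hasLineDerivAt v)
  have hint : Integrable (fun x ↦ (ψ x - φ x ^ 2) * ‖f x‖ ^ 2) := by
    simpa only [sub_mul] using! hψf.sub hφφf
  refine ⟨hint, ?_⟩
  have hsq : 0 ≤ ∫ x, ‖fderiv ℝ f x v + φ x • f x‖ ^ 2 := by positivity
  have hexp : ∀ x, ‖fderiv ℝ f x v + φ x • f x‖ ^ 2 = ‖fderiv ℝ f x v‖ ^ 2 +
      φ x * (2 * inner ℝ (f x) (fderiv ℝ f x v)) + φ x ^ 2 * ‖f x‖ ^ 2 := fun x ↦ by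
    rw [norm_add_sq_real, inner_smul_right, norm_smul, mul_pow, Real.norm_eq_abs, sq_abs,
      real_inner_comm]
    ring
  have hf' := f.integrable_norm_fderiv_sq v
  simp_rw [hexp] at hsq
  rw [integral_add (hf'.fun_add hφf') hφφf, integral_add hf' hφf', hparts] at hsq
  simp_rw [sub_mul]
  rw [integral_sub hψf hφφf]
  linarith

end Schwartz

theorem hasLineDerivAt_inner_div_norm_sq_add {E : Type*} [NormedAddCommGroup E]
    [InnerProductSpace ℝ E] (a : ℝ) {ε : ℝ} (hε : 0 < ε) {v : E} (hv : ‖v‖ = 1) (x : E) :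
    HasLineDerivAt ℝ (fun y ↦ a * (inner ℝ y v / (‖y‖ ^ 2 + ε)))
      (a * (1 / (‖x‖ ^ 2 + ε) - 2 * inner ℝ x v ^ 2 / (‖x‖ ^ 2 + ε) ^ 2)) x v := by
  have hline : HasDerivAt (fun t : ℝ ↦ x + t • v) v 0 := by
    simpa using ((hasDerivAt_id (0 : ℝ)).smul_const v).const_add x
  have hne : ‖x‖ ^ 2 + ε ≠ 0 := by positivity
  have h := (((hline.inner ℝ (hasDerivAt_const 0 v)).div (hline.norm_sq.add_const ε)
    (by simpa using hne)).const_mul a)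
  unfold HasLineDerivAt
  convert! h using 1
  simp only [zero_smul, add_zero, inner_zero_right, zero_add, real_inner_self_eq_norm_sq, hv]
  field_simp

theorem regularized_hardy_inequality {N : ℕ} {a ε : ℝ} (ha : 0 ≤ a) (hε : 0 < ε)
    (f : SchwartzMap (EuclideanSpace ℝ (Fin N)) ℂ) :
    (a * (N - 2) - a ^ 2) * ∫ x : EuclideanSpace ℝ (Fin N), ‖f x‖ ^ 2 / (‖x‖ ^ 2 + ε)
      ≤ ∫ x : EuclideanSpace ℝ (Fin N), gradSq (⇑f) x := by
  let φ : Fin N → EuclideanSpace ℝ (Fin N) → ℝ := fun i x ↦ a * (x i / (‖x‖ ^ 2 + ε))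
  let ψ : Fin N → EuclideanSpace ℝ (Fin N) → ℝ := fun i x ↦
    a * (1 / (‖x‖ ^ 2 + ε) - 2 * x i ^ 2 / (‖x‖ ^ 2 + ε) ^ 2)
  have hpos (x : EuclideanSpace ℝ (Fin N)) : 0 < ‖x‖ ^ 2 + ε := by positivity
  have hcoord (x : EuclideanSpace ℝ (Fin N)) (i : Fin N) : x i ^ 2 ≤ ‖x‖ ^ 2 := by
    rw [EuclideanSpace.real_norm_sq_eq]
    exact Finset.single_le_sum (f := fun i ↦ x i ^ 2) (fun _ _ ↦ sq_nonneg _) (Finset.mem_univ i)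
  have hφcont (i : Fin N) : Continuous (φ i) := by
    simp only [φ]
    fun_prop (disch := exact fun x ↦ (hpos x).ne')
  have hψcont (i : Fin N) : Continuous (ψ i) := by
    simp only [ψ]
    fun_prop (disch := exact fun x ↦ by have := hpos x; positivity)
  have hw (x : EuclideanSpace ℝ (Fin N)) : 1 / (‖x‖ ^ 2 + ε) ≤ 1 / ε :=
    one_div_le_one_div_of_le hε (by nlinarith [sq_nonneg ‖x‖])
  have hφC (i : Fin N) (x) : |φ i x| ≤ a * (1 + 1 / ε) := by
    simp only [φ]
    rw [abs_mul, abs_of_nonneg ha, abs_div, abs_of_pos (hpos x)]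
    gcongr
    have h1 : |x i| ≤ ‖x‖ ^ 2 + 1 := by
      nlinarith [hcoord x i, sq_abs (x i), sq_nonneg (|x i| - 1), abs_nonneg (x i)]
    rw [div_le_iff₀ (hpos x)]
    have : (1 + 1 / ε) * (‖x‖ ^ 2 + ε) = ‖x‖ ^ 2 + 1 + (ε + ‖x‖ ^ 2 / ε) := by
      field_simp; ring
    rw [this]
    have : 0 ≤ ε + ‖x‖ ^ 2 / ε := by positivity
    linarith
  have hxw (x : EuclideanSpace ℝ (Fin N)) (i : Fin N) :
      x i ^ 2 / (‖x‖ ^ 2 + ε) ^ 2 ≤ 1 / (‖x‖ ^ 2 + ε) := by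
    rw [div_le_div_iff₀ (by have := hpos x; positivity) (hpos x)]
    nlinarith [hcoord x i, hpos x]
  have hψC (i : Fin N) (x) : |ψ i x| ≤ a * (1 + 1 / ε) := by
    simp only [ψ]
    rw [abs_mul, abs_of_nonneg ha]
    gcongr
    have h0 : 0 ≤ x i ^ 2 / (‖x‖ ^ 2 + ε) ^ 2 := by positivity
    rw [mul_div_assoc, abs_le]
    constructor <;> linarith [hw x, hxw x i]
  have key (i : Fin N) := f.integral_sub_sq_mul_norm_sq_le (EuclideanSpace.single i 1)
    (hφcont i) (hψcont i) (hφC i) (hψC i) fun x ↦ by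
      simpa [φ, ψ, EuclideanSpace.inner_single_right] using hasLineDerivAt_inner_div_norm_sq_add a hε
        (v := EuclideanSpace.single i (1 : ℝ)) (by simp) x
  have hfw : Integrable (fun x : EuclideanSpace ℝ (Fin N) ↦ ‖f x‖ ^ 2 / (‖x‖ ^ 2 + ε)) := by
    have := f.integrable_norm_sq.mul_bdd (c := 1 / ε) (g := fun x ↦ 1 / (‖x‖ ^ 2 + ε))
      (Continuous.aestronglyMeasurable
        (by fun_prop (disch := exact fun x ↦ (hpos x).ne')))
      (.of_forall fun x ↦ by
        rw [Real.norm_of_nonneg (by positivity)]; exact hw x)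
    simpa only [mul_one_div] using this
  calc
    _ = ∫ x, (a * (N - 2) - a ^ 2) * (‖f x‖ ^ 2 / (‖x‖ ^ 2 + ε)) := (integral_const_mul _ _).symm
    _ ≤ ∫ x, ∑ i, (ψ i x - φ i x ^ 2) * ‖f x‖ ^ 2 := by
      refine integral_mono (hfw.const_mul _) (integrable_finsetSum _ fun i _ ↦ (key i).1)
        fun x ↦ ?_
      have hsum : ∑ i, (ψ i x - φ i x ^ 2) =
          a * N / (‖x‖ ^ 2 + ε) - (2 * a + a ^ 2) * (‖x‖ ^ 2 / (‖x‖ ^ 2 + ε) ^ 2) := by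
        have hterm (i : Fin N) : ψ i x - φ i x ^ 2 = a / (‖x‖ ^ 2 + ε) -
            (2 * a + a ^ 2) / (‖x‖ ^ 2 + ε) ^ 2 * x i ^ 2 := by
          simp only [φ, ψ]
          field_simp
          ring
        simp_rw [hterm]
        rw [Finset.sum_sub_distrib, ← Finset.mul_sum, ← EuclideanSpace.real_norm_sq_eq]
        simp only [Finset.sum_const, Finset.card_univ, Fintype.card_fin, nsmul_eq_mul]
        ring
      have hle : ‖x‖ ^ 2 / (‖x‖ ^ 2 + ε) ^ 2 ≤ 1 / (‖x‖ ^ 2 + ε) := by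
        rw [div_le_div_iff₀ (by have := hpos x; positivity) (hpos x)]
        nlinarith [hpos x]
      have hcoef : (a * (N - 2) - a ^ 2) * (1 / (‖x‖ ^ 2 + ε)) ≤ ∑ i, (ψ i x - φ i x ^ 2) := by
        rw [hsum]
        have := mul_le_mul_of_nonneg_left hle (by positivity : 0 ≤ 2 * a + a ^ 2)
        rw [show a * N / (‖x‖ ^ 2 + ε) = a * N * (1 / (‖x‖ ^ 2 + ε)) by ring]
        linarith
      have := mul_le_mul_of_nonneg_right hcoef (sq_nonneg ‖f x‖)
      rw [← Finset.sum_mul]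
      refine le_trans (le_of_eq ?_) this
      ring
    _ = ∑ i, ∫ x, (ψ i x - φ i x ^ 2) * ‖f x‖ ^ 2 := integral_finsetSum _ fun i _ ↦ (key i).1
    _ ≤ ∑ i, ∫ x, ‖fderiv ℝ f x (EuclideanSpace.single i 1)‖ ^ 2 :=
      Finset.sum_le_sum fun i _ ↦ (key i).2
    _ = _ := (integral_finsetSum _ fun i _ ↦ f.integrable_norm_fderiv_sq _).symm

/-- Sharp Hardy inequality: for `N ≥ 3` and every Schwartz function `f : ℝ^N → ℂ`,
`((N-2)²/4) ∫ |x|⁻² |f(x)|² dx ≤ ∫ |∇f(x)|² dx`. -/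
theorem sharp_hardy_inequality (N : ℕ) (hN : 3 ≤ N)
    (f : SchwartzMap (EuclideanSpace ℝ (Fin N)) ℂ) :
    ((N : ℝ) - 2) ^ 2 / 4 * ∫ x : EuclideanSpace ℝ (Fin N), ‖f x‖ ^ 2 / ‖x‖ ^ 2
      ≤ ∫ x : EuclideanSpace ℝ (Fin N), gradSq (⇑f) x := by
  have hN' : (3 : ℝ) ≤ N := by exact_mod_cast hN
  by_cases hint : Integrable fun x : EuclideanSpace ℝ (Fin N) ↦ ‖f x‖ ^ 2 / ‖x‖ ^ 2
  swap
  · rw [integral_undef hint, mul_zero]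
    exact integral_nonneg fun x ↦ Finset.sum_nonneg fun i _ ↦ sq_nonneg _
  have : Nonempty (Fin N) := ⟨⟨0, by lia⟩⟩
  have hne : ∀ᵐ x : EuclideanSpace ℝ (Fin N), x ≠ 0 := by
    simp [ae_iff]
  have hlim : Tendsto
      (fun ε : ℝ ↦ ∫ x : EuclideanSpace ℝ (Fin N), ‖f x‖ ^ 2 / (‖x‖ ^ 2 + ε)) (𝓝[>] 0)
      (𝓝 (∫ x : EuclideanSpace ℝ (Fin N), ‖f x‖ ^ 2 / ‖x‖ ^ 2)) := by
    refine tendsto_integral_filter_of_dominated_convergence _ ?_ ?_ hint ?_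
    · refine .of_forall fun ε ↦ Measurable.aestronglyMeasurable ?_
      have := f.continuous.measurable
      fun_prop
    · filter_upwards [self_mem_nhdsWithin] with ε (hε : 0 < ε)
      filter_upwards [hne] with x hx
      have : 0 < ‖x‖ := norm_pos_iff.2 hx
      rw [Real.norm_of_nonneg (by positivity)]
      gcongr
      linarith
    · filter_upwards [hne] with x hx
      have : ‖x‖ ^ 2 + 0 ≠ 0 := by simpa using hx
      have hcont : ContinuousAt (fun ε : ℝ ↦ ‖f x‖ ^ 2 / (‖x‖ ^ 2 + ε)) 0 := by
        fun_prop (disch := assumption)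
      simpa using hcont.tendsto.mono_left nhdsWithin_le_nhds
  refine le_of_tendsto (hlim.const_mul _) ?_
  filter_upwards [self_mem_nhdsWithin] with ε (hε : 0 < ε)
  have h := regularized_hardy_inequality (a := (N - 2) / 2) (by linarith) hε f
  rwa [show ((N : ℝ) - 2) / 2 * (N - 2) - ((N - 2) / 2) ^ 2 = (N - 2) ^ 2 / 4 by ring] at h
end

section
/- Let N ≥ 3 be an integer, λ_N := (N−2)²/4, λ > −λ_N, and set κ := √λ_N − √(λ_N + λ). Then for every smooth compactly supported function f : ℝ^N∖{0} → ℂ (i.e. f ∈ C_c^∞(ℝ^N∖{0})) one has the identity ∫_{ℝ^N} [ |∇f(x)|² + λ |x|^{-2} |f(x)|² ] dx = ∫_{ℝ^N} | ∇f(x) + κ |x|^{-2} x f(x) |² dx. -/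
open MeasureTheory

/-- The integral of a directional derivative of a compactly supported `C¹` function vanishes. -/
theorem integral_fderiv_apply_eq_zero {E : Type*} [NormedAddCommGroup E] [NormedSpace ℝ E]
    [FiniteDimensional ℝ E] [MeasurableSpace E] [BorelSpace E] {μ : Measure E}
    [μ.IsAddHaarMeasure] {g : E → ℝ} (hg : ContDiff ℝ 1 g) (hgc : HasCompactSupport g) (v : E) :
    ∫ x, fderiv ℝ g x v ∂μ = 0 := by
  have hint : Integrable (fun x ↦ fderiv ℝ g x v) μ :=
    ((hg.continuous_fderiv one_ne_zero).clm_apply continuous_const).integrable_of_hasCompactSupport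
      (hgc.fderiv_apply ℝ v)
  simpa using integral_mul_fderiv_eq_neg_fderiv_mul_of_integrable (𝕜 := ℝ) (μ := μ)
    (f := fun _ ↦ (1 : ℝ)) (g := g) (v := v) (by simp) (by simpa using hint)
    (by simpa using hg.continuous.integrable_of_hasCompactSupport hgc) (by simp)
    (fun x _ ↦ (hg.differentiable one_ne_zero) x)

/-- Dividing the squared modulus by `‖x‖ ^ 2` preserves smoothness for a function supported away
from the origin. -/
theorem contDiff_norm_sq_div_norm_sq {E : Type*} [NormedAddCommGroup E] [InnerProductSpace ℝ E]
    {n : WithTop ℕ∞} {f : E → ℂ} (hf : ContDiff ℝ n f) (h0 : (0 : E) ∉ tsupport f) :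
    ContDiff ℝ n (fun x ↦ ‖f x‖ ^ 2 / ‖x‖ ^ 2) := by
  rw [contDiff_iff_contDiffAt]
  intro x
  by_cases hx : x ∈ tsupport f
  · have hx0 : x ≠ 0 := fun h ↦ h0 (h ▸ hx)
    exact (hf.norm_sq ℝ).contDiffAt.div (contDiff_norm_sq ℝ).contDiffAt (by simpa using hx0)
  · refine (contDiffAt_const (c := (0 : ℝ))).congr_of_eventuallyEq ?_
    filter_upwards [notMem_tsupport_iff_eventuallyEq.1 hx] with y hy
    simp [hy]

theorem norm_add_ofReal_mul_sq (z w : ℂ) (a : ℝ) :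
    ‖z + (a : ℂ) * w‖ ^ 2 = ‖z‖ ^ 2 + a * (2 * inner ℝ w z) + a ^ 2 * ‖w‖ ^ 2 := by
  rw [← Complex.real_smul, norm_add_sq_real, norm_smul, inner_smul_right, real_inner_comm, mul_pow,
    Real.norm_eq_abs, sq_abs]
  ring

/-- Expansion of `|∇f + κ|x|⁻² x f|²` up to the divergence of the field `κ|x|⁻²|f|² x`. -/
theorem sum_norm_fderiv_add_sq {N : ℕ} {f : EuclideanSpace ℝ (Fin N) → ℂ}
    (hf : ContDiff ℝ 1 f) (h0 : (0 : EuclideanSpace ℝ (Fin N)) ∉ tsupport f) (κ : ℝ)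
    (x : EuclideanSpace ℝ (Fin N)) :
    ∑ i, ‖fderiv ℝ f x (EuclideanSpace.single i 1) + ((κ * x i / ‖x‖ ^ 2 : ℝ) : ℂ) * f x‖ ^ 2
      = gradSq f x + (κ ^ 2 - κ * (N - 2)) * (‖f x‖ ^ 2 / ‖x‖ ^ 2)
        + κ * ∑ i, fderiv ℝ (fun y ↦ ‖f y‖ ^ 2 / ‖y‖ ^ 2 * y i) x (EuclideanSpace.single i 1) := by
  by_cases hx : x ∈ tsupport f
  · have hx0 : x ≠ 0 := fun h ↦ h0 (h ▸ hx)
    have hnx : ‖x‖ ^ 2 ≠ 0 := by simpa using hx0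
    set w : EuclideanSpace ℝ (Fin N) → ℝ := fun y ↦ ‖f y‖ ^ 2 / ‖y‖ ^ 2 with hw
    have hwd : HasFDerivAt w (fderiv ℝ w x) x :=
      ((contDiff_norm_sq_div_norm_sq hf h0).differentiable one_ne_zero x).hasFDerivAt
    have hfd : HasFDerivAt f (fderiv ℝ f x) x := (hf.differentiable one_ne_zero x).hasFDerivAt
    have hdiv (i : Fin N) :
        fderiv ℝ (fun y ↦ ‖f y‖ ^ 2 / ‖y‖ ^ 2 * y i) x (EuclideanSpace.single i 1)
          = w x + x i * fderiv ℝ w x (EuclideanSpace.single i 1) := by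
      have := hwd.mul (EuclideanSpace.proj (𝕜 := ℝ) i).hasFDerivAt
      rw [show (fun y ↦ ‖f y‖ ^ 2 / ‖y‖ ^ 2 * y i) = w * ⇑(EuclideanSpace.proj (𝕜 := ℝ) i) from rfl,
        this.fderiv]
      simp
    have hprod : (fun y ↦ ‖f y‖ ^ 2) = fun y ↦ w y * ‖y‖ ^ 2 := by
      funext y
      rcases eq_or_ne y 0 with rfl | hy
      · simp [image_eq_zero_of_notMem_tsupport h0]
      · have : ‖y‖ ^ 2 ≠ 0 := by simpa using hy
        simp only [hw]
        field_simp
    have hinner (i : Fin N) :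
        2 * inner ℝ (f x) (fderiv ℝ f x (EuclideanSpace.single i 1))
          = fderiv ℝ w x (EuclideanSpace.single i 1) * ‖x‖ ^ 2 + w x * (2 * x i) := by
      have h1 := hfd.norm_sq
      rw [hprod] at h1
      have h2 := hwd.mul (hasFDerivAt_id x).norm_sq
      have h3 := DFunLike.congr_fun (h1.unique h2) (EuclideanSpace.single i 1)
      simp [EuclideanSpace.inner_single_right] at h3
      rw [Complex.inner]
      simp
      linarith
    have hterm (i : Fin N) :
        ‖fderiv ℝ f x (EuclideanSpace.single i 1) + ((κ * x i / ‖x‖ ^ 2 : ℝ) : ℂ) * f x‖ ^ 2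
          = ‖fderiv ℝ f x (EuclideanSpace.single i 1)‖ ^ 2
            + κ * (w x + x i * fderiv ℝ w x (EuclideanSpace.single i 1)) - κ * w x
            + (2 * κ + κ ^ 2) * w x / ‖x‖ ^ 2 * x i ^ 2 := by
      rw [norm_add_ofReal_mul_sq, hinner, congrFun hprod x]
      field_simp
      ring
    have hsum : ∑ i, x i ^ 2 = ‖x‖ ^ 2 := (EuclideanSpace.real_norm_sq_eq x).symm
    simp_rw [hterm, hdiv, gradSq]
    rw [Finset.sum_add_distrib, Finset.sum_sub_distrib, Finset.sum_add_distrib, ← Finset.mul_sum,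
      ← Finset.mul_sum, ← Finset.mul_sum, hsum, div_mul_cancel₀ _ hnx]
    simp only [Finset.sum_const, Finset.card_univ, Fintype.card_fin, nsmul_eq_mul]
    change _ = _ + _ * w x + _
    ring
  · have hev := notMem_tsupport_iff_eventuallyEq.1 hx
    have hf0 : fderiv ℝ f x = 0 := by simpa using hev.fderiv_eq (𝕜 := ℝ)
    have hd (i : Fin N) : fderiv ℝ (fun y ↦ ‖f y‖ ^ 2 / ‖y‖ ^ 2 * y i) x = 0 := by
      have : (fun y : EuclideanSpace ℝ (Fin N) ↦ ‖f y‖ ^ 2 / ‖y‖ ^ 2 * y i)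
          =ᶠ[nhds x] fun _ ↦ (0 : ℝ) := by
        filter_upwards [hev] with y hy
        simp [hy]
      simpa using this.fderiv_eq (𝕜 := ℝ)
    simp [gradSq, hf0, hd, image_eq_zero_of_notMem_tsupport hx]

/-- For `N ≥ 3`, `λ > -(N-2)²/4` and `κ = √λ_N - √(λ_N + λ)`, every
`f ∈ C_c^∞(ℝ^N \ {0})` satisfies
`∫ (|∇f|² + λ|x|⁻²|f|²) dx = ∫ |∇f + κ|x|⁻² x f|² dx`. -/
theorem quadratic_form_identity (N : ℕ) (hN : 3 ≤ N) (lam : ℝ)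
    (hlam : -(((N : ℝ) - 2) ^ 2 / 4) < lam)
    (f : EuclideanSpace ℝ (Fin N) → ℂ)
    (hf_smooth : ContDiff ℝ (⊤ : ℕ∞) f)
    (hf_comp : HasCompactSupport f)
    (hf_supp : (0 : EuclideanSpace ℝ (Fin N)) ∉ tsupport f) :
    (∫ x : EuclideanSpace ℝ (Fin N),
        (gradSq f x + lam * (‖f x‖ ^ 2 / ‖x‖ ^ 2)))
      = ∫ x : EuclideanSpace ℝ (Fin N),
          ∑ i, ‖fderiv ℝ f x (EuclideanSpace.single i 1)
              + (((Real.sqrt (((N : ℝ) - 2) ^ 2 / 4)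
                    - Real.sqrt (((N : ℝ) - 2) ^ 2 / 4 + lam)) * x i / ‖x‖ ^ 2 : ℝ) : ℂ)
                  * f x‖ ^ 2 := by
  have hf1 : ContDiff ℝ 1 f := hf_smooth.of_le (by exact_mod_cast le_top)
  have hκ : lam = (√(((N : ℝ) - 2) ^ 2 / 4) - √(((N : ℝ) - 2) ^ 2 / 4 + lam)) ^ 2
      - (√(((N : ℝ) - 2) ^ 2 / 4) - √(((N : ℝ) - 2) ^ 2 / 4 + lam)) * ((N : ℝ) - 2) := by
    have hN' : (0 : ℝ) ≤ ((N : ℝ) - 2) / 2 := by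
      have : (3 : ℝ) ≤ N := by exact_mod_cast hN
      linarith
    have h1 : √(((N : ℝ) - 2) ^ 2 / 4) = ((N : ℝ) - 2) / 2 := by
      rw [← Real.sqrt_sq hN']
      ring_nf
    have h2 : √(((N : ℝ) - 2) ^ 2 / 4 + lam) ^ 2 = ((N : ℝ) - 2) ^ 2 / 4 + lam :=
      Real.sq_sqrt (by linarith)
    rw [h1]
    linear_combination -h2
  set κ := √(((N : ℝ) - 2) ^ 2 / 4) - √(((N : ℝ) - 2) ^ 2 / 4 + lam)
  have hw := contDiff_norm_sq_div_norm_sq hf1 hf_supp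
  have hwc : HasCompactSupport (fun x ↦ ‖f x‖ ^ 2 / ‖x‖ ^ 2) :=
    hf_comp.mono fun x hx ↦ by
      contrapose! hx
      simp_all
  have hg (i : Fin N) :
      ContDiff ℝ 1 (fun y : EuclideanSpace ℝ (Fin N) ↦ ‖f y‖ ^ 2 / ‖y‖ ^ 2 * y i) :=
    hw.mul (EuclideanSpace.proj (𝕜 := ℝ) i).contDiff
  have hgc (i : Fin N) :
      HasCompactSupport (fun y : EuclideanSpace ℝ (Fin N) ↦ ‖f y‖ ^ 2 / ‖y‖ ^ 2 * y i) :=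
    hwc.mul_right
  have hgi (i : Fin N) : Integrable (fun x ↦ fderiv ℝ
      (fun y : EuclideanSpace ℝ (Fin N) ↦ ‖f y‖ ^ 2 / ‖y‖ ^ 2 * y i) x
        (EuclideanSpace.single i 1)) :=
    (((hg i).continuous_fderiv one_ne_zero).clm_apply
      continuous_const).integrable_of_hasCompactSupport ((hgc i).fderiv_apply ℝ _)
  have hgrad : Integrable (gradSq f) := by
    refine integrable_finsetSum _ fun i _ ↦ ?_
    refine Continuous.integrable_of_hasCompactSupport (((hf1.continuous_fderiv
      one_ne_zero).clm_apply continuous_const).norm.pow 2) ?_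
    exact (hf_comp.fderiv_apply ℝ (EuclideanSpace.single i 1)).comp_left
      (g := fun z : ℂ ↦ ‖z‖ ^ 2) (by simp)
  simp_rw [sum_norm_fderiv_add_sq hf1 hf_supp κ, ← hκ]
  have hleft : Integrable (fun x ↦ gradSq f x + lam * (‖f x‖ ^ 2 / ‖x‖ ^ 2)) :=
    hgrad.add ((hw.continuous.integrable_of_hasCompactSupport hwc).const_mul lam)
  rw [integral_add hleft ((integrable_finsetSum _ fun i _ ↦ hgi i).const_mul κ), integral_const_mul,
    integral_finsetSum _ fun i _ ↦ hgi i]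
  simp [integral_fderiv_apply_eq_zero (hg _) (hgc _)]
end

section
/- Let N ≥ 3 be an integer, λ_N := (N−2)²/4, 0 < b < 2, λ > −λ_N and 1 < p < 1 + (4−2b)/(N−2). Set ν := N(p−1)/2 + b. Then there exists a constant C > 0 such that for every Schwartz function u : ℝ^N → ℂ one has the weighted Gagliardo–Nirenberg inequality ∫_{ℝ^N} |x|^{-b} |u(x)|^{p+1} dx ≤ C ( ∫_{ℝ^N} |u|² dx )^{(p+1−ν)/2} ( Q_λ(u) )^{ν/2}. -/
open MeasureTheory

/-- The Hardy quadratic form `Q_λ(u) = ∫ |∇u|² dx + λ ∫ |x|⁻² |u|² dx`. -/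
noncomputable def hardyForm {N : ℕ} (lam : ℝ) (u : EuclideanSpace ℝ (Fin N) → ℂ) : ℝ :=
  (∫ x : EuclideanSpace ℝ (Fin N), gradSq u x)
    + lam * ∫ x : EuclideanSpace ℝ (Fin N), ‖u x‖ ^ 2 / ‖x‖ ^ 2


section WeightedGN

variable {N : ℕ}

lemma integrable_norm_sq_schwartz {F : Type*} [NormedAddCommGroup F] [NormedSpace ℝ F]
    (u : SchwartzMap (EuclideanSpace ℝ (Fin N)) F) :
    Integrable (fun x => ‖u x‖ ^ 2) := by
  simpa using (u.memLp 2).integrable_norm_pow (by norm_num)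

lemma integrable_norm_sq_partial (u : SchwartzMap (EuclideanSpace ℝ (Fin N)) ℂ) (i : Fin N) :
    Integrable (fun x => ‖fderiv ℝ u x (EuclideanSpace.single i 1)‖ ^ 2) := by
  have hd : Integrable (fun x => ‖fderiv ℝ u x‖ ^ 2) :=
    integrable_norm_sq_schwartz (SchwartzMap.fderivCLM ℝ _ _ u)
  have hc : Continuous (fderiv ℝ u) := (u.smooth 1).continuous_fderiv one_ne_zero
  refine hd.mono' (by fun_prop) (Filter.Eventually.of_forall fun x => ?_)
  rw [Real.norm_of_nonneg (by positivity)]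
  gcongr
  simpa using (fderiv ℝ u x).le_opNorm (EuclideanSpace.single i 1)

lemma integrable_gradSq (u : SchwartzMap (EuclideanSpace ℝ (Fin N)) ℂ) :
    Integrable (gradSq u) :=
  integrable_finsetSum _ fun i _ => integrable_norm_sq_partial u i

lemma gradSq_nonneg (f : EuclideanSpace ℝ (Fin N) → ℂ) (x : EuclideanSpace ℝ (Fin N)) :
    0 ≤ gradSq f x :=
  Finset.sum_nonneg fun _ _ => by positivity

/-- Partial derivatives of the regularised Hardy vector field `x / (|x|² + ε)`. -/
lemma hasFDerivAt_hardyField {ε : ℝ} (hε : 0 < ε) (i : Fin N) (x : EuclideanSpace ℝ (Fin N)) :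
    ∃ L : EuclideanSpace ℝ (Fin N) →L[ℝ] ℝ,
      HasFDerivAt (fun y : EuclideanSpace ℝ (Fin N) => y i * (‖y‖ ^ 2 + ε)⁻¹) L x ∧
      L (EuclideanSpace.single i 1)
        = (‖x‖ ^ 2 + ε)⁻¹ - 2 * (x i) ^ 2 * ((‖x‖ ^ 2 + ε)⁻¹) ^ 2 := by
  have hne : ‖x‖ ^ 2 + ε ≠ 0 := by positivity
  have h1 : HasFDerivAt (fun y : EuclideanSpace ℝ (Fin N) => ‖y‖ ^ 2 + ε)
      (2 • innerSL ℝ x) x := (hasStrictFDerivAt_norm_sq x).hasFDerivAt.add_const ε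
  have h2 : HasFDerivAt (fun y : EuclideanSpace ℝ (Fin N) => (‖y‖ ^ 2 + ε)⁻¹) _ x :=
    (hasDerivAt_inv hne).comp_hasFDerivAt x h1
  have h3 : HasFDerivAt (fun y : EuclideanSpace ℝ (Fin N) => y i)
      (EuclideanSpace.proj i : EuclideanSpace ℝ (Fin N) →L[ℝ] ℝ) x :=
    (EuclideanSpace.proj i : EuclideanSpace ℝ (Fin N) →L[ℝ] ℝ).hasFDerivAt
  refine ⟨_, h3.mul h2, ?_⟩
  simp [EuclideanSpace.inner_single_right]
  field_simp
  ring

lemma fderiv_normSq_apply (u : SchwartzMap (EuclideanSpace ℝ (Fin N)) ℂ)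
    (x v : EuclideanSpace ℝ (Fin N)) :
    fderiv ℝ (fun y => ‖u y‖ ^ 2) x v = 2 * inner ℝ (u x) (fderiv ℝ u x v) := by
  have h : HasFDerivAt (fun y => ‖u y‖ ^ 2) _ x :=
    (u.differentiableAt (x := x)).hasFDerivAt.norm_sq
  rw [h.fderiv]
  simp only [smul_apply, ContinuousLinearMap.comp_apply, innerSL_apply_apply,
    nsmul_eq_mul, Nat.cast_ofNat]

lemma hardy_regularised_pointwise (ε c : ℝ)
    (u : SchwartzMap (EuclideanSpace ℝ (Fin N)) ℂ) (x : EuclideanSpace ℝ (Fin N)) :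
    -∑ i, (c * (x i * (‖x‖ ^ 2 + ε)⁻¹
        * fderiv ℝ (fun y => ‖u y‖ ^ 2) x (EuclideanSpace.single i 1)))
      ≤ gradSq u x + c ^ 2 * (‖x‖ ^ 2 * ((‖x‖ ^ 2 + ε)⁻¹) ^ 2 * ‖u x‖ ^ 2) := by
  set w := (‖x‖ ^ 2 + ε)⁻¹ with hw
  have h : 0 ≤ ∑ i, ‖fderiv ℝ u x (EuclideanSpace.single i 1) + (c * (x i * w)) • u x‖ ^ 2 :=
    Finset.sum_nonneg fun _ _ => by positivity
  have hx : ‖x‖ ^ 2 = ∑ i, (x i) ^ 2 := by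
    simp [EuclideanSpace.norm_sq_eq]
  have key : ∑ i, ‖fderiv ℝ u x (EuclideanSpace.single i 1) + (c * (x i * w)) • u x‖ ^ 2
      = gradSq u x + ∑ i, (c * (x i * w
        * fderiv ℝ (fun y => ‖u y‖ ^ 2) x (EuclideanSpace.single i 1)))
        + c ^ 2 * (‖x‖ ^ 2 * w ^ 2 * ‖u x‖ ^ 2) := by
    rw [hx, gradSq]
    simp only [Finset.sum_mul, Finset.mul_sum, ← Finset.sum_add_distrib]
    refine Finset.sum_congr rfl fun i _ => ?_
    rw [norm_add_sq_real, fderiv_normSq_apply, norm_smul, inner_smul_right, mul_pow,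
      Real.norm_eq_abs, sq_abs, real_inner_comm]
    ring
  linarith

lemma abs_coord_mul_inv_le {ε : ℝ} (hε : 0 < ε) (i : Fin N) (x : EuclideanSpace ℝ (Fin N)) :
    ‖x i * (‖x‖ ^ 2 + ε)⁻¹‖ ≤ 1 + ε⁻¹ := by
  have hpos : 0 < ‖x‖ ^ 2 + ε := by positivity
  have h1 : ‖x i‖ ≤ ‖x‖ := PiLp.norm_apply_le x i
  rw [norm_mul, norm_inv, Real.norm_of_nonneg hpos.le, ← div_eq_mul_inv, div_le_iff₀ hpos]
  have h2 : (1 + ε⁻¹) * (‖x‖ ^ 2 + ε) = ‖x‖ ^ 2 + ε + ‖x‖ ^ 2 * ε⁻¹ + 1 := by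
    field_simp
    ring
  have h3 : 0 ≤ ‖x‖ ^ 2 * ε⁻¹ := by positivity
  nlinarith [sq_nonneg (‖x‖ - 1)]

lemma integrable_inv_mul_norm_sq {ε : ℝ} (hε : 0 < ε)
    (u : SchwartzMap (EuclideanSpace ℝ (Fin N)) ℂ) :
    Integrable (fun x => (‖x‖ ^ 2 + ε)⁻¹ * ‖u x‖ ^ 2) := by
  have hcont : Continuous fun x : EuclideanSpace ℝ (Fin N) => (‖x‖ ^ 2 + ε)⁻¹ :=
    Continuous.inv₀ (by fun_prop) fun x => by positivity
  refine (integrable_norm_sq_schwartz u).bdd_mul (c := ε⁻¹) hcont.aestronglyMeasurable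
    (Filter.Eventually.of_forall fun x => ?_)
  rw [Real.norm_of_nonneg (by positivity)]
  exact inv_anti₀ hε (by linarith [sq_nonneg ‖x‖])

lemma integrable_sq_mul_inv_sq_mul_norm_sq {ε : ℝ} (hε : 0 < ε)
    (u : SchwartzMap (EuclideanSpace ℝ (Fin N)) ℂ) {f : EuclideanSpace ℝ (Fin N) → ℝ}
    (hf : Continuous f) (hfx : ∀ x, ‖f x‖ ≤ ‖x‖ ^ 2) :
    Integrable (fun x => f x * ((‖x‖ ^ 2 + ε)⁻¹) ^ 2 * ‖u x‖ ^ 2) := by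
  have hcont : Continuous fun x : EuclideanSpace ℝ (Fin N) => (‖x‖ ^ 2 + ε)⁻¹ :=
    Continuous.inv₀ (by fun_prop) fun x => by positivity
  refine (integrable_inv_mul_norm_sq hε u).mono' (by fun_prop)
    (Filter.Eventually.of_forall fun x => ?_)
  rw [norm_mul, norm_mul, Real.norm_of_nonneg (sq_nonneg (_⁻¹)),
    Real.norm_of_nonneg (sq_nonneg ‖u x‖)]
  gcongr
  have hpos : 0 < ‖x‖ ^ 2 + ε := by positivity
  calc ‖f x‖ * ((‖x‖ ^ 2 + ε)⁻¹) ^ 2 ≤ (‖x‖ ^ 2 + ε) * ((‖x‖ ^ 2 + ε)⁻¹) ^ 2 := by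
        gcongr
        linarith [hfx x]
    _ = (‖x‖ ^ 2 + ε)⁻¹ := by field_simp

lemma integral_hardyField_mul_fderiv {ε : ℝ} (hε : 0 < ε)
    (u : SchwartzMap (EuclideanSpace ℝ (Fin N)) ℂ) (i : Fin N) :
    Integrable (fun x : EuclideanSpace ℝ (Fin N) => x i * (‖x‖ ^ 2 + ε)⁻¹
        * fderiv ℝ (fun y => ‖u y‖ ^ 2) x (EuclideanSpace.single i 1)) ∧
    ∫ x : EuclideanSpace ℝ (Fin N), x i * (‖x‖ ^ 2 + ε)⁻¹
        * fderiv ℝ (fun y => ‖u y‖ ^ 2) x (EuclideanSpace.single i 1)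
      = -((∫ x, (‖x‖ ^ 2 + ε)⁻¹ * ‖u x‖ ^ 2)
        - 2 * ∫ x, (x i) ^ 2 * ((‖x‖ ^ 2 + ε)⁻¹) ^ 2 * ‖u x‖ ^ 2) := by
  have hd : ContDiff ℝ 1 (fun y => ‖u y‖ ^ 2) := (u.smooth 1).norm_sq ℝ
  have hcu := u.continuous
  have hcd : Continuous (fderiv ℝ u) := (u.smooth 1).continuous_fderiv one_ne_zero
  have hcd' : Continuous (fderiv ℝ (fun y => ‖u y‖ ^ 2)) := hd.continuous_fderiv one_ne_zero
  have hcw : Continuous fun x : EuclideanSpace ℝ (Fin N) => (‖x‖ ^ 2 + ε)⁻¹ :=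
    Continuous.inv₀ (by fun_prop) fun x => by positivity
  have hF : ∀ x, fderiv ℝ (fun y : EuclideanSpace ℝ (Fin N) => y i * (‖y‖ ^ 2 + ε)⁻¹) x
      (EuclideanSpace.single i 1)
        = (‖x‖ ^ 2 + ε)⁻¹ - 2 * (x i) ^ 2 * ((‖x‖ ^ 2 + ε)⁻¹) ^ 2 := fun x => by
    obtain ⟨L, hL, hL'⟩ := hasFDerivAt_hardyField hε i x
    rw [hL.fderiv, hL']
  have hg' : Integrable (fun x => fderiv ℝ (fun y => ‖u y‖ ^ 2) x
      (EuclideanSpace.single i 1)) := by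
    refine ((integrable_norm_sq_schwartz u).add (integrable_norm_sq_partial u i)).mono'
      (by fun_prop) (Filter.Eventually.of_forall fun x => ?_)
    rw [fderiv_normSq_apply, norm_mul, Real.norm_ofNat]
    have := norm_inner_le_norm (𝕜 := ℝ) (u x) (fderiv ℝ u x (EuclideanSpace.single i 1))
    simp only [Pi.add_apply]
    nlinarith [sq_nonneg (‖u x‖ - ‖fderiv ℝ u x (EuclideanSpace.single i 1)‖)]
  have hFm : AEStronglyMeasurable
      (fun x : EuclideanSpace ℝ (Fin N) => x i * (‖x‖ ^ 2 + ε)⁻¹) :=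
    Continuous.aestronglyMeasurable (by fun_prop)
  have hb := Filter.Eventually.of_forall (f := ae (volume : Measure (EuclideanSpace ℝ (Fin N))))
    (abs_coord_mul_inv_le hε i)
  have hi1 := integrable_inv_mul_norm_sq hε u
  have hi2 : Integrable (fun x : EuclideanSpace ℝ (Fin N) =>
      (x i) ^ 2 * ((‖x‖ ^ 2 + ε)⁻¹) ^ 2 * ‖u x‖ ^ 2) :=
    integrable_sq_mul_inv_sq_mul_norm_sq hε u (by fun_prop) fun x => by
      rw [norm_pow]
      gcongr
      exact PiLp.norm_apply_le x i
  have hfg' := hg'.bdd_mul hFm hb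
  have heq : (fun x : EuclideanSpace ℝ (Fin N) =>
      fderiv ℝ (fun y : EuclideanSpace ℝ (Fin N) => y i * (‖y‖ ^ 2 + ε)⁻¹) x
        (EuclideanSpace.single i 1) * ‖u x‖ ^ 2)
      = fun x => (‖x‖ ^ 2 + ε)⁻¹ * ‖u x‖ ^ 2
        - 2 * ((x i) ^ 2 * ((‖x‖ ^ 2 + ε)⁻¹) ^ 2 * ‖u x‖ ^ 2) := by
    ext x
    rw [hF]
    ring
  refine ⟨hfg', ?_⟩
  rw [integral_mul_fderiv_eq_neg_fderiv_mul_of_integrable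
    (by rw [heq]; exact hi1.sub (hi2.const_mul 2)) hfg'
    ((integrable_norm_sq_schwartz u).bdd_mul hFm hb)
    (fun x _ => by
      obtain ⟨L, hL, -⟩ := hasFDerivAt_hardyField hε i x
      exact hL.differentiableAt)
    (fun x _ => hd.differentiable one_ne_zero x), heq, integral_sub hi1 (hi2.const_mul 2),
    integral_const_mul]

/-- Hardy's inequality with the regularised weight `1 / (|x|² + ε)`. -/
lemma hardy_regularised (hN : 3 ≤ N) {ε : ℝ} (hε : 0 < ε)
    (u : SchwartzMap (EuclideanSpace ℝ (Fin N)) ℂ) :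
    ((N : ℝ) - 2) ^ 2 / 4 * ∫ x, (‖x‖ ^ 2 + ε)⁻¹ * ‖u x‖ ^ 2 ≤ ∫ x, gradSq u x := by
  have hN' : (3 : ℝ) ≤ N := by exact_mod_cast hN
  set c : ℝ := ((N : ℝ) - 2) / 2 with hc
  have hc0 : 0 ≤ c := by rw [hc]; linarith
  set A := ∫ x, (‖x‖ ^ 2 + ε)⁻¹ * ‖u x‖ ^ 2 with hA
  set B := ∫ x, ‖x‖ ^ 2 * ((‖x‖ ^ 2 + ε)⁻¹) ^ 2 * ‖u x‖ ^ 2 with hB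
  have hiA := integrable_inv_mul_norm_sq hε u
  have hiB : Integrable (fun x => ‖x‖ ^ 2 * ((‖x‖ ^ 2 + ε)⁻¹) ^ 2 * ‖u x‖ ^ 2) :=
    integrable_sq_mul_inv_sq_mul_norm_sq hε u (by fun_prop) fun x => by simp
  have hiBi : ∀ i, Integrable (fun x : EuclideanSpace ℝ (Fin N) =>
      (x i) ^ 2 * ((‖x‖ ^ 2 + ε)⁻¹) ^ 2 * ‖u x‖ ^ 2) := fun i =>
    integrable_sq_mul_inv_sq_mul_norm_sq hε u (by fun_prop) fun x => by
      rw [norm_pow]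
      gcongr
      exact PiLp.norm_apply_le x i
  have hBA : B ≤ A := integral_mono hiB hiA fun x => by
    have hpos : 0 < ‖x‖ ^ 2 + ε := by positivity
    change ‖x‖ ^ 2 * ((‖x‖ ^ 2 + ε)⁻¹) ^ 2 * ‖u x‖ ^ 2 ≤ (‖x‖ ^ 2 + ε)⁻¹ * ‖u x‖ ^ 2
    gcongr
    calc ‖x‖ ^ 2 * ((‖x‖ ^ 2 + ε)⁻¹) ^ 2 ≤ (‖x‖ ^ 2 + ε) * ((‖x‖ ^ 2 + ε)⁻¹) ^ 2 := by
          gcongr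
          linarith
      _ = (‖x‖ ^ 2 + ε)⁻¹ := by field_simp
  have hsumB : ∑ i, ∫ x : EuclideanSpace ℝ (Fin N),
      (x i) ^ 2 * ((‖x‖ ^ 2 + ε)⁻¹) ^ 2 * ‖u x‖ ^ 2 = B := by
    rw [← integral_finsetSum _ fun i _ => hiBi i]
    refine integral_congr_ae (Filter.Eventually.of_forall fun x => ?_)
    simp only [EuclideanSpace.norm_sq_eq, Finset.sum_mul, Real.norm_eq_abs, sq_abs]
  have hmono := integral_mono
    (integrable_finsetSum Finset.univ fun i _ =>
      (integral_hardyField_mul_fderiv hε u i).1.const_mul c).neg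
    ((integrable_gradSq u).add (hiB.const_mul (c ^ 2)))
    (fun x => hardy_regularised_pointwise ε c u x)
  simp only [Pi.neg_apply, Pi.add_apply] at hmono
  rw [integral_neg, integral_finsetSum _ fun i _ =>
      (integral_hardyField_mul_fderiv hε u i).1.const_mul c,
    integral_add (integrable_gradSq u) (hiB.const_mul (c ^ 2)), integral_const_mul] at hmono
  simp only [integral_const_mul, fun i => (integral_hardyField_mul_fderiv hε u i).2] at hmono
  rw [← Finset.mul_sum, Finset.sum_neg_distrib, Finset.sum_sub_distrib, ← Finset.mul_sum,
    hsumB, Finset.sum_const, Finset.card_univ, Fintype.card_fin, nsmul_eq_mul] at hmono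
  have h1 : (c ^ 2 + 2 * c) * B ≤ (c ^ 2 + 2 * c) * A := by gcongr
  have h2 : ((N : ℝ) - 2) ^ 2 / 4 = c ^ 2 := by rw [hc]; ring
  have h3 : (N : ℝ) = 2 * c + 2 := by rw [hc]; ring
  rw [h2]
  rw [h3] at hmono
  nlinarith

/-- **Hardy's inequality** with its sharp constant, for Schwartz functions. -/
lemma hardy_schwartz (hN : 3 ≤ N) (u : SchwartzMap (EuclideanSpace ℝ (Fin N)) ℂ) :
    Integrable (fun x => ‖u x‖ ^ 2 / ‖x‖ ^ 2) ∧
    ((N : ℝ) - 2) ^ 2 / 4 * ∫ x, ‖u x‖ ^ 2 / ‖x‖ ^ 2 ≤ ∫ x, gradSq u x := by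
  have hN' : (3 : ℝ) ≤ N := by exact_mod_cast hN
  set l : ℝ := ((N : ℝ) - 2) ^ 2 / 4 with hl
  have hl0 : 0 < l := by
    have : 0 < (N : ℝ) - 2 := by linarith
    positivity
  set G := ∫ x, gradSq u x with hG
  have hG0 : 0 ≤ G := integral_nonneg (gradSq_nonneg _)
  have hcu := u.continuous
  have hcw : ∀ n : ℕ, Continuous fun x : EuclideanSpace ℝ (Fin N) =>
      (‖x‖ ^ 2 + 1 / ((n : ℝ) + 1))⁻¹ := fun n =>
    Continuous.inv₀ (by fun_prop) fun x => by positivity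
  have hm : Measurable (fun x => ‖u x‖ ^ 2 / ‖x‖ ^ 2) :=
    (hcu.norm.pow 2).measurable.div (continuous_norm.pow 2).measurable
  have hle : ∫⁻ x, ENNReal.ofReal (‖u x‖ ^ 2 / ‖x‖ ^ 2) ≤ ENNReal.ofReal (G / l) := by
    have hpt : ∀ x : EuclideanSpace ℝ (Fin N), ENNReal.ofReal (‖u x‖ ^ 2 / ‖x‖ ^ 2) ≤
        Filter.liminf (fun n : ℕ => ENNReal.ofReal
          ((‖x‖ ^ 2 + 1 / ((n : ℝ) + 1))⁻¹ * ‖u x‖ ^ 2)) Filter.atTop := fun x => by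
      rcases eq_or_ne x 0 with rfl | hx
      · simp
      · refine le_of_eq (Filter.Tendsto.liminf_eq ?_).symm
        refine (ENNReal.continuous_ofReal.tendsto _).comp ?_
        rw [div_eq_inv_mul]
        have h0 : ‖x‖ ^ 2 ≠ 0 := by positivity
        have := (tendsto_one_div_add_atTop_nhds_zero_nat (𝕜 := ℝ)).const_add (‖x‖ ^ 2)
        rw [add_zero] at this
        exact (this.inv₀ h0).mul_const _
    calc ∫⁻ x, ENNReal.ofReal (‖u x‖ ^ 2 / ‖x‖ ^ 2)
        ≤ ∫⁻ x, Filter.liminf (fun n : ℕ => ENNReal.ofReal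
          ((‖x‖ ^ 2 + 1 / ((n : ℝ) + 1))⁻¹ * ‖u x‖ ^ 2)) Filter.atTop := lintegral_mono hpt
      _ ≤ Filter.liminf (fun n : ℕ => ∫⁻ x, ENNReal.ofReal
          ((‖x‖ ^ 2 + 1 / ((n : ℝ) + 1))⁻¹ * ‖u x‖ ^ 2)) Filter.atTop :=
        lintegral_liminf_le fun n => ENNReal.measurable_ofReal.comp
          ((hcw n).mul (hcu.norm.pow 2)).measurable
      _ ≤ Filter.liminf (fun _ : ℕ => ENNReal.ofReal (G / l)) Filter.atTop := by
        refine Filter.liminf_le_liminf (Filter.Eventually.of_forall fun n => ?_)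
        have hε : (0 : ℝ) < 1 / ((n : ℝ) + 1) := by positivity
        rw [← ofReal_integral_eq_lintegral_ofReal (integrable_inv_mul_norm_sq hε u)
          (Filter.Eventually.of_forall fun x => by positivity)]
        refine ENNReal.ofReal_le_ofReal ?_
        rw [le_div_iff₀' hl0]
        exact hardy_regularised hN hε u
      _ = ENNReal.ofReal (G / l) := by simp
  have hnn : 0 ≤ᵐ[volume] fun x => ‖u x‖ ^ 2 / ‖x‖ ^ 2 :=
    Filter.Eventually.of_forall fun x => by positivity
  refine ⟨⟨hm.aestronglyMeasurable, ?_⟩, ?_⟩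
  · rw [hasFiniteIntegral_iff_ofReal hnn]
    exact hle.trans_lt ENNReal.ofReal_lt_top
  · rw [integral_eq_lintegral_of_nonneg_ae hnn hm.aestronglyMeasurable, ← le_div_iff₀' hl0]
    exact ENNReal.toReal_le_of_le_ofReal (by positivity) hle

lemma norm_fderiv_sq_le_gradSq (f : EuclideanSpace ℝ (Fin N) → ℂ)
    (x : EuclideanSpace ℝ (Fin N)) : ‖fderiv ℝ f x‖ ^ 2 ≤ gradSq f x := by
  suffices h : ‖fderiv ℝ f x‖ ≤ √(gradSq f x) by
    calc ‖fderiv ℝ f x‖ ^ 2 ≤ √(gradSq f x) ^ 2 := by gcongr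
      _ = gradSq f x := Real.sq_sqrt (gradSq_nonneg f x)
  refine ContinuousLinearMap.opNorm_le_bound _ (Real.sqrt_nonneg _) fun v => ?_
  have hv : v = ∑ i, v i • EuclideanSpace.single i (1 : ℝ) := by
    ext j
    simp [Finset.sum_apply, Pi.single_apply]
  have h1 : ‖fderiv ℝ f x v‖ ≤ ∑ i, ‖fderiv ℝ f x (EuclideanSpace.single i 1)‖ * |v i| := by
    conv_lhs => rw [hv, map_sum]
    refine (norm_sum_le _ _).trans (Finset.sum_le_sum fun i _ => ?_)
    rw [map_smul, norm_smul, Real.norm_eq_abs, mul_comm]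
  refine h1.trans ((Real.sum_mul_le_sqrt_mul_sqrt _ _ _).trans (le_of_eq ?_))
  rw [gradSq, EuclideanSpace.norm_eq v]
  simp

/-- Smooth compactly supported cutoffs `χ (x / (n + 1))` with uniformly controlled gradients. -/
lemma exists_cutoff_seq : ∃ K : ℝ, 0 ≤ K ∧ ∃ χ : ℕ → EuclideanSpace ℝ (Fin N) → ℝ,
    (∀ n, ContDiff ℝ 1 (χ n)) ∧ (∀ n, HasCompactSupport (χ n)) ∧ (∀ n x, |χ n x| ≤ 1) ∧
    (∀ n x, ‖fderiv ℝ (χ n) x‖ ≤ K * (1 / ((n : ℝ) + 1))) ∧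
    ∀ x, Filter.Tendsto (fun n => χ n x) Filter.atTop (nhds 1) := by
  let φ : ContDiffBump (0 : EuclideanSpace ℝ (Fin N)) := ⟨1, 2, one_pos, one_lt_two⟩
  have hφ : ContDiff ℝ 1 φ := φ.contDiff
  obtain ⟨K, hK⟩ := (φ.hasCompactSupport.fderiv ℝ).exists_bound_of_continuous
    (hφ.continuous_fderiv one_ne_zero)
  have hpos : ∀ n : ℕ, (0 : ℝ) < 1 / ((n : ℝ) + 1) := fun n => by positivity
  refine ⟨K, (norm_nonneg _).trans (hK 0), fun n x => φ ((1 / ((n : ℝ) + 1)) • x),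
    fun n => hφ.comp (contDiff_id.const_smul _),
    fun n => φ.hasCompactSupport.comp_smul (hpos n).ne',
    fun n x => by rw [abs_of_nonneg φ.nonneg]; exact φ.le_one, fun n x => ?_, fun x => ?_⟩
  · rw [fderiv_comp_smul, norm_smul, Real.norm_of_nonneg (hpos n).le, mul_comm]
    gcongr
    exact hK _
  · have h := (tendsto_one_div_add_atTop_nhds_zero_nat (𝕜 := ℝ)).smul_const x
    rw [zero_smul] at h
    have hlim := (hφ.continuous.tendsto _).comp h
    rwa [φ.one_of_mem_closedBall (by simp [φ])] at hlim

/-- The **Sobolev inequality** for Schwartz functions. -/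
lemma eLpNorm_le_eLpNorm_fderiv_schwartz {p p' : NNReal} (hp : 1 ≤ p) (hN : 0 < N)
    (hp' : (p' : ℝ)⁻¹ = (p : ℝ)⁻¹ - (N : ℝ)⁻¹)
    (u : SchwartzMap (EuclideanSpace ℝ (Fin N)) ℂ) :
    eLpNorm u p' volume ≤ SNormLESNormFDerivOfEqConst ℂ
      (volume : Measure (EuclideanSpace ℝ (Fin N))) p * eLpNorm (fderiv ℝ u) p volume := by
  obtain ⟨K, hK0, χ, hχd, hχc, hχ1, hχK, hχt⟩ := exists_cutoff_seq (N := N)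
  set C := SNormLESNormFDerivOfEqConst ℂ (volume : Measure (EuclideanSpace ℝ (Fin N))) p
  have hu : ContDiff ℝ 1 u := u.smooth 1
  have hcd : Continuous (fderiv ℝ u) := hu.continuous_fderiv one_ne_zero
  have hcu := u.continuous
  let v : ℕ → EuclideanSpace ℝ (Fin N) → ℂ := fun n x => χ n x • u x
  have hv : ∀ n, ContDiff ℝ 1 (v n) := fun n => (hχd n).smul hu
  have hgrad : ∀ n, eLpNorm (fderiv ℝ (v n)) p volume ≤ eLpNorm (fderiv ℝ u) p volume
      + ENNReal.ofReal (K * (1 / ((n : ℝ) + 1))) * eLpNorm u p volume := fun n => by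
    have hpt : ∀ x, ‖fderiv ℝ (v n) x‖
        ≤ ‖‖fderiv ℝ u x‖ + (K * (1 / ((n : ℝ) + 1))) * ‖u x‖‖ := fun x => by
      have hd := ((hχd n).differentiable one_ne_zero x).hasFDerivAt.smul
        (hu.differentiable one_ne_zero x).hasFDerivAt
      rw [show fderiv ℝ (v n) x = _ from hd.fderiv]
      rw [Real.norm_of_nonneg (by positivity)]
      refine (norm_add_le _ _).trans (add_le_add ?_ ?_)
      · rw [norm_smul, Real.norm_eq_abs]
        exact mul_le_of_le_one_left (norm_nonneg _) (hχ1 n x)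
      · rw [ContinuousLinearMap.norm_smulRight_apply]
        gcongr
        exact hχK n x
    refine (eLpNorm_mono hpt).trans ?_
    refine (eLpNorm_add_le (f := fun x => ‖fderiv ℝ u x‖)
      (g := fun x => (K * (1 / ((n : ℝ) + 1))) * ‖u x‖)
      (by fun_prop) (by fun_prop) (by exact_mod_cast hp)).trans ?_
    refine add_le_add (eLpNorm_norm _).le (le_of_eq ?_)
    have := eLpNorm_const_smul (K * (1 / ((n : ℝ) + 1))) (fun x => ‖u x‖) p
      (volume : Measure (EuclideanSpace ℝ (Fin N)))
    rw [eLpNorm_norm, Real.enorm_of_nonneg (by positivity)] at this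
    exact this
  have hsob : ∀ n, eLpNorm (v n) p' volume ≤ C * (eLpNorm (fderiv ℝ u) p volume
      + ENNReal.ofReal (K * (1 / ((n : ℝ) + 1))) * eLpNorm u p volume) := fun n =>
    (eLpNorm_le_eLpNorm_fderiv_of_eq volume (hv n) ((hχc n).smul_right) hp
      (by simpa using hN) (by simpa using hp')).trans (by gcongr; exact hgrad n)
  have hlim : Filter.Tendsto (fun n : ℕ => (C : ENNReal) * (eLpNorm (fderiv ℝ u) p volume
      + ENNReal.ofReal (K * (1 / ((n : ℝ) + 1))) * eLpNorm u p volume)) Filter.atTop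
      (nhds (C * eLpNorm (fderiv ℝ u) p volume)) := by
    have h0 : Filter.Tendsto (fun n : ℕ => ENNReal.ofReal (K * (1 / ((n : ℝ) + 1))))
        Filter.atTop (nhds 0) := by
      have := (tendsto_one_div_add_atTop_nhds_zero_nat (𝕜 := ℝ)).const_mul K
      rw [mul_zero] at this
      simpa only [ENNReal.ofReal_zero, Function.comp_def]
        using (ENNReal.continuous_ofReal.tendsto _).comp this
    have h1 := ENNReal.Tendsto.mul_const h0
      (Or.inr (u.memLp p volume).eLpNorm_ne_top)
    have h2 := h1.const_add (eLpNorm (fderiv ℝ u) p volume)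
    rw [zero_mul, add_zero] at h2
    exact ENNReal.Tendsto.const_mul h2 (Or.inr ENNReal.coe_ne_top)
  calc eLpNorm u p' volume
      ≤ Filter.liminf (fun n => eLpNorm (v n) p' volume) Filter.atTop :=
        Lp.eLpNorm_lim_le_liminf_eLpNorm
          (fun n => (hv n).continuous.aestronglyMeasurable) u
          (Filter.Eventually.of_forall fun x => by
            simpa only [one_smul] using (hχt x).smul_const (u x))
    _ ≤ Filter.liminf (fun n : ℕ => (C : ENNReal) * (eLpNorm (fderiv ℝ u) p volume
      + ENNReal.ofReal (K * (1 / ((n : ℝ) + 1))) * eLpNorm u p volume)) Filter.atTop :=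
        Filter.liminf_le_liminf (Filter.Eventually.of_forall hsob)
    _ = C * eLpNorm (fderiv ℝ u) p volume := hlim.liminf_eq

/-- The Sobolev inequality for the critical exponent `2N / (N - 2)`, in integral form. -/
lemma exists_lintegral_rpow_le_gradSq (hN : 3 ≤ N) :
    ∃ K : ℝ, 0 ≤ K ∧ ∀ u : SchwartzMap (EuclideanSpace ℝ (Fin N)) ℂ,
      ∫⁻ x, ENNReal.ofReal (‖u x‖ ^ (2 * (N : ℝ) / ((N : ℝ) - 2)))
        ≤ ENNReal.ofReal (K * (∫ x, gradSq u x) ^ ((N : ℝ) / ((N : ℝ) - 2))) := by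
  have hN' : (3 : ℝ) ≤ N := by exact_mod_cast hN
  have hN2 : (0 : ℝ) < (N : ℝ) - 2 := by linarith
  set s : ℝ := 2 * (N : ℝ) / ((N : ℝ) - 2) with hs
  have hs0 : 0 < s := by positivity
  set C := SNormLESNormFDerivOfEqConst ℂ (volume : Measure (EuclideanSpace ℝ (Fin N)))
    (2 : NNReal) with hC
  refine ⟨(C : ℝ) ^ s, by positivity, fun u => ?_⟩
  set G := ∫ x, gradSq u x with hG
  have hG0 : 0 ≤ G := integral_nonneg (gradSq_nonneg _)
  have hsob := eLpNorm_le_eLpNorm_fderiv_schwartz (p := 2) (p' := s.toNNReal) one_le_two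
    (by omega) (by
      rw [Real.coe_toNNReal s hs0.le, hs]
      push_cast
      field_simp) u
  rw [← hC, ENNReal.coe_ofNat] at hsob
  have hgrad : eLpNorm (fderiv ℝ u) 2 volume ≤ ENNReal.ofReal (G ^ (1 / 2 : ℝ)) := by
    rw [eLpNorm_eq_lintegral_rpow_enorm_toReal two_ne_zero ENNReal.ofNat_ne_top,
      ← ENNReal.ofReal_rpow_of_nonneg hG0 (by norm_num), hG,
      ofReal_integral_eq_lintegral_ofReal (integrable_gradSq u)
        (Filter.Eventually.of_forall (gradSq_nonneg _))]
    simp only [ENNReal.toReal_ofNat]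
    gcongr with x
    rw [← ofReal_norm, ENNReal.ofReal_rpow_of_nonneg (norm_nonneg _) zero_le_two]
    refine ENNReal.ofReal_le_ofReal ?_
    rw [Real.rpow_two]
    exact norm_fderiv_sq_le_gradSq u x
  have hS : ∫⁻ x, ENNReal.ofReal (‖u x‖ ^ s) = eLpNorm u s.toNNReal volume ^ s := by
    have h := eLpNorm_nnreal_pow_eq_lintegral (p := s.toNNReal) (f := u) (μ := volume)
      (Real.toNNReal_pos.2 hs0).ne'
    rw [Real.coe_toNNReal s hs0.le] at h
    rw [h]
    refine lintegral_congr fun x => ?_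
    rw [← ofReal_norm, ENNReal.ofReal_rpow_of_nonneg (norm_nonneg _) hs0.le]
  rw [hS]
  calc eLpNorm u s.toNNReal volume ^ s
      ≤ (C * ENNReal.ofReal (G ^ (1 / 2 : ℝ))) ^ s := by
        gcongr
        exact hsob.trans (by gcongr)
    _ = ENNReal.ofReal ((C : ℝ) ^ s * G ^ ((N : ℝ) / ((N : ℝ) - 2))) := by
        rw [← ENNReal.ofReal_coe_nnreal, ← ENNReal.ofReal_mul (by positivity),
          ENNReal.ofReal_rpow_of_nonneg (by positivity) hs0.le,
          Real.mul_rpow (by positivity) (by positivity), ← Real.rpow_mul hG0]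
        congr 3
        rw [hs]
        field_simp

/-- Coercivity of the Hardy form above the critical parameter. -/
lemma exists_gradSq_le_hardyForm (hN : 3 ≤ N) {lam : ℝ}
    (hlam : -(((N : ℝ) - 2) ^ 2 / 4) < lam) :
    ∃ A : ℝ, 0 < A ∧ ∀ u : SchwartzMap (EuclideanSpace ℝ (Fin N)) ℂ,
      ∫ x, gradSq u x ≤ A * hardyForm lam u := by
  have hN' : (3 : ℝ) ≤ N := by exact_mod_cast hN
  set l : ℝ := ((N : ℝ) - 2) ^ 2 / 4 with hl
  have hl0 : 0 < l := by
    have : 0 < (N : ℝ) - 2 := by linarith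
    positivity
  have hH0 : ∀ u : SchwartzMap (EuclideanSpace ℝ (Fin N)) ℂ,
      0 ≤ ∫ x, ‖u x‖ ^ 2 / ‖x‖ ^ 2 := fun u => integral_nonneg fun x => by positivity
  rcases le_or_gt 0 lam with h | h
  · refine ⟨1, one_pos, fun u => ?_⟩
    have := mul_nonneg h (hH0 u)
    rw [one_mul, hardyForm]
    linarith
  · have hd : 0 < l + lam := by linarith
    refine ⟨l / (l + lam), by positivity, fun u => ?_⟩
    have hH := (hardy_schwartz hN u).2
    rw [div_mul_eq_mul_div, le_div_iff₀ hd, hardyForm]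
    have := mul_le_mul_of_nonneg_left hH (neg_nonneg.2 h.le)
    rw [← hl] at this
    linarith

/-- Hölder interpolation of the weighted integral between the Hardy, mass and critical terms. -/
lemma integral_weighted_le (u : SchwartzMap (EuclideanSpace ℝ (Fin N)) ℂ) {b q s α β S : ℝ}
    (hb : 0 < b) (hs : 0 < s) (hα : 0 ≤ α) (hβ : 0 < β) (hsum : b / 2 + α + β = 1)
    (hq : b + 2 * α + s * β = q)
    (hH : Integrable (fun x => ‖u x‖ ^ 2 / ‖x‖ ^ 2)) (hS0 : 0 ≤ S)
    (hS : ∫⁻ x, ENNReal.ofReal (‖u x‖ ^ s) ≤ ENNReal.ofReal S) :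
    ∫ x : EuclideanSpace ℝ (Fin N), ‖x‖ ^ (-b) * ‖u x‖ ^ q
      ≤ (∫ x, ‖u x‖ ^ 2 / ‖x‖ ^ 2) ^ (b / 2) * (∫ x, ‖u x‖ ^ 2) ^ α * S ^ β := by
  have hcu := u.continuous
  have hm := hcu.measurable
  have hq0 : 0 < q := by rw [← hq]; positivity
  have hMi := integrable_norm_sq_schwartz u
  have hnonneg : ∀ x, 0 ≤ ‖u x‖ ^ 2 / ‖x‖ ^ 2 := fun x => by positivity
  have hH0 : 0 ≤ ∫ x, ‖u x‖ ^ 2 / ‖x‖ ^ 2 := integral_nonneg hnonneg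
  have hM0 : 0 ≤ ∫ x, ‖u x‖ ^ 2 := integral_nonneg fun x => by positivity
  rw [integral_eq_lintegral_of_nonneg_ae (Filter.Eventually.of_forall fun x => by positivity)
    (by fun_prop)]
  refine ENNReal.toReal_le_of_le_ofReal (by positivity) ?_
  let f : Fin 3 → EuclideanSpace ℝ (Fin N) → ENNReal :=
    ![fun x => ENNReal.ofReal (‖u x‖ ^ 2 / ‖x‖ ^ 2), fun x => ENNReal.ofReal (‖u x‖ ^ 2),
      fun x => ENNReal.ofReal (‖u x‖ ^ s)]
  let e : Fin 3 → ℝ := ![b / 2, α, β]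
  have hpt : ∀ x : EuclideanSpace ℝ (Fin N),
      ENNReal.ofReal (‖x‖ ^ (-b) * ‖u x‖ ^ q) = ∏ i, f i x ^ e i := fun x => by
    simp only [Fin.prod_univ_three, f, e, Matrix.cons_val]
    rw [ENNReal.ofReal_rpow_of_nonneg (by positivity) (by positivity),
      ENNReal.ofReal_rpow_of_nonneg (by positivity) hα,
      ENNReal.ofReal_rpow_of_nonneg (by positivity) hβ.le,
      ← ENNReal.ofReal_mul (by positivity), ← ENNReal.ofReal_mul (by positivity)]
    congr 1
    rw [Real.div_rpow (by positivity) (by positivity), ← Real.rpow_natCast_mul (by positivity),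
      ← Real.rpow_natCast_mul (by positivity), ← Real.rpow_natCast_mul (by positivity),
      ← Real.rpow_mul (by positivity), Real.rpow_neg (by positivity), ← hq,
      Real.rpow_add_of_nonneg (by positivity) (by positivity) (by positivity),
      Real.rpow_add_of_nonneg (by positivity) (by positivity) (by positivity)]
    push_cast
    rw [mul_div_cancel₀ b two_ne_zero]
    ring
  have hholder := ENNReal.lintegral_prod_norm_pow_le (μ := volume) Finset.univ (f := f)
    (p := e) (fun i _ => by
      fin_cases i
      · exact (ENNReal.measurable_ofReal.comp
          ((hm.norm.pow_const 2).div (measurable_norm.pow_const 2))).aemeasurable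
      · exact (ENNReal.measurable_ofReal.comp (hm.norm.pow_const 2)).aemeasurable
      · exact (ENNReal.measurable_ofReal.comp (hm.norm.pow_const s)).aemeasurable)
    (by simp [Fin.sum_univ_three, e, hsum])
    (fun i _ => by fin_cases i <;> simp [e] <;> positivity)
  calc ∫⁻ x, ENNReal.ofReal (‖x‖ ^ (-b) * ‖u x‖ ^ q) = ∫⁻ x, ∏ i, f i x ^ e i :=
        lintegral_congr hpt
    _ ≤ ∏ i, (∫⁻ x, f i x) ^ e i := hholder
    _ ≤ ENNReal.ofReal (∫ x, ‖u x‖ ^ 2 / ‖x‖ ^ 2) ^ (b / 2)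
        * ENNReal.ofReal (∫ x, ‖u x‖ ^ 2) ^ α * ENNReal.ofReal S ^ β := by
        simp only [Fin.prod_univ_three, f, e, Matrix.cons_val]
        rw [ofReal_integral_eq_lintegral_ofReal hH (Filter.Eventually.of_forall hnonneg),
          ofReal_integral_eq_lintegral_ofReal hMi
            (Filter.Eventually.of_forall fun x => by positivity)]
        gcongr
    _ = _ := by
        rw [ENNReal.ofReal_rpow_of_nonneg hH0 (by positivity),
          ENNReal.ofReal_rpow_of_nonneg hM0 hα, ENNReal.ofReal_rpow_of_nonneg hS0 hβ.le,
          ← ENNReal.ofReal_mul (by positivity), ← ENNReal.ofReal_mul (by positivity)]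

end WeightedGN

/-- Weighted Gagliardo–Nirenberg inequality: for `N ≥ 3`, `0 < b < 2`,
`λ > -(N-2)²/4`, `1 < p < 1 + (4-2b)/(N-2)` and `ν = N(p-1)/2 + b`, there is
`C > 0` such that every Schwartz `u` satisfies
`∫ |x|^{-b}|u|^{p+1} dx ≤ C (∫ |u|²)^{(p+1-ν)/2} (Q_λ(u))^{ν/2}`. -/
theorem weighted_gagliardo_nirenberg (N : ℕ) (hN : 3 ≤ N) (b lam p : ℝ)
    (hb0 : 0 < b) (hb2 : b < 2)
    (hlam : -(((N : ℝ) - 2) ^ 2 / 4) < lam)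
    (hp1 : 1 < p) (hp2 : p < 1 + (4 - 2 * b) / ((N : ℝ) - 2)) :
    ∃ C : ℝ, 0 < C ∧
      ∀ u : SchwartzMap (EuclideanSpace ℝ (Fin N)) ℂ,
        (∫ x : EuclideanSpace ℝ (Fin N), ‖x‖ ^ (-b) * ‖u x‖ ^ (p + 1))
          ≤ C * (∫ x : EuclideanSpace ℝ (Fin N), ‖u x‖ ^ 2)
                  ^ ((p + 1 - ((N : ℝ) * (p - 1) / 2 + b)) / 2)
              * hardyForm lam ⇑u ^ (((N : ℝ) * (p - 1) / 2 + b) / 2) := by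
  have hN' : (3 : ℝ) ≤ N := by exact_mod_cast hN
  have hN2 : (0 : ℝ) < (N : ℝ) - 2 := by linarith
  obtain ⟨K, hK0, hK⟩ := exists_lintegral_rpow_le_gradSq hN
  obtain ⟨A, hA0, hA⟩ := exists_gradSq_le_hardyForm hN hlam
  set l : ℝ := ((N : ℝ) - 2) ^ 2 / 4 with hl
  have hl0 : 0 < l := by positivity
  set ν : ℝ := (N : ℝ) * (p - 1) / 2 + b with hν
  set α : ℝ := (p + 1 - ν) / 2 with hα
  set β : ℝ := (p - 1) * ((N : ℝ) - 2) / 4 with hβ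
  have hβ0 : 0 < β := by
    have : 0 < p - 1 := by linarith
    positivity
  have hα0 : 0 < α := by
    have h : (p - 1) * ((N : ℝ) - 2) < 4 - 2 * b := by
      rw [← lt_div_iff₀ hN2]
      linarith
    rw [hα, hν]
    linarith
  set C₀ : ℝ := (A / l) ^ (b / 2) * (K * A ^ ((N : ℝ) / ((N : ℝ) - 2))) ^ β with hC₀
  have hC₀0 : 0 ≤ C₀ := by positivity
  refine ⟨C₀ + 1, by positivity, fun u => ?_⟩
  set G := ∫ x, gradSq u x with hG
  set M := ∫ x : EuclideanSpace ℝ (Fin N), ‖u x‖ ^ 2 with hM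
  set Q := hardyForm lam u with hQ
  have hG0 : 0 ≤ G := integral_nonneg (gradSq_nonneg _)
  have hM0 : 0 ≤ M := integral_nonneg fun x => by positivity
  have hGQ : G ≤ A * Q := hA u
  have hQ0 : 0 ≤ Q := nonneg_of_mul_nonneg_right (hG0.trans hGQ) hA0
  obtain ⟨hHi, hH⟩ := hardy_schwartz hN u
  have hH0 : 0 ≤ ∫ x : EuclideanSpace ℝ (Fin N), ‖u x‖ ^ 2 / ‖x‖ ^ 2 :=
    integral_nonneg fun x => by positivity
  have hHQ : ∫ x : EuclideanSpace ℝ (Fin N), ‖u x‖ ^ 2 / ‖x‖ ^ 2 ≤ A / l * Q := by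
    rw [div_mul_eq_mul_div, le_div_iff₀' hl0]
    exact hH.trans hGQ
  have hmain := integral_weighted_le u (q := p + 1) (s := 2 * (N : ℝ) / ((N : ℝ) - 2)) hb0
    (by positivity) hα0.le hβ0 (by rw [hα, hβ, hν]; ring)
    (by rw [hα, hβ, hν]; field_simp; ring) hHi (by positivity) (hK u)
  calc ∫ x : EuclideanSpace ℝ (Fin N), ‖x‖ ^ (-b) * ‖u x‖ ^ (p + 1)
      ≤ (∫ x, ‖u x‖ ^ 2 / ‖x‖ ^ 2) ^ (b / 2) * M ^ α
          * (K * G ^ ((N : ℝ) / ((N : ℝ) - 2))) ^ β := hmain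
    _ ≤ (A / l * Q) ^ (b / 2) * M ^ α
          * (K * (A * Q) ^ ((N : ℝ) / ((N : ℝ) - 2))) ^ β := by gcongr
    _ = C₀ * M ^ α * Q ^ (ν / 2) := by
      have hν2 : ν / 2 = b / 2 + (N : ℝ) / ((N : ℝ) - 2) * β := by
        rw [hν, hβ]
        field_simp
        ring
      rw [Real.mul_rpow (by positivity) hQ0, Real.mul_rpow hA0.le hQ0, ← mul_assoc K,
        Real.mul_rpow (by positivity) (by positivity), ← Real.rpow_mul hQ0, hν2,
        Real.rpow_add_of_nonneg hQ0 (by positivity) (by positivity), hC₀]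
      ring
    _ ≤ (C₀ + 1) * M ^ α * Q ^ (ν / 2) := by
      gcongr
      linarith
end

section
/- Let N ≥ 3 be an integer, 0 < b < 4/N, p := (N+2−2b)/(N−2), σ := 2N/(N−2) (so σ' = 2N/(N+2)), and r := 2N(N+2−2b)/(N² − 2Nb + 4). Let I ⊆ ℝ be an interval. Then there exists a constant C > 0, independent of I, such that for every function u : I × ℝ^N → ℂ which is jointly measurable and such that u(t,·) is a Schwartz function for each t ∈ I, the following mixed-norm estimate holds (in [0,∞], i.e. both sides may be infinite): ( ∫_I ( ∫_{ℝ^N} |∇_x( |x|^{-b} |u(t,x)|^{p−1} u(t,x) )|^{σ'} dx )^{2/σ'} dt )^{1/2} ≤ C ( ∫_I ( ∫_{ℝ^N} |∇_x u(t,x)|^{r} dx )^{2p/r} dt )^{1/2}. -/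
open MeasureTheory

/-- Euclidean length of the gradient of a complex-valued function on `ℝ^N`:
`|∇f(x)| = (∑ i ‖∂ᵢ f(x)‖²)^{1/2}`. -/
noncomputable def gradLen {N : ℕ} (f : EuclideanSpace ℝ (Fin N) → ℂ)
    (x : EuclideanSpace ℝ (Fin N)) : ℝ :=
  Real.sqrt (∑ i, ‖fderiv ℝ f x (EuclideanSpace.single i 1)‖ ^ 2)

open Filter Topology Set
open scoped ENNReal NNReal SchwartzMap

/-- The Gagliardo-Nirenberg-Sobolev inequality for `C¹` functions that are `p`-integrable,
without the assumption of compact support. -/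
theorem eLpNorm_le_eLpNorm_fderiv_of_memLp {E F : Type*} [NormedAddCommGroup E]
    [InnerProductSpace ℝ E] [FiniteDimensional ℝ E] [MeasurableSpace E] [BorelSpace E]
    [NormedAddCommGroup F] [NormedSpace ℝ F] [FiniteDimensional ℝ F]
    (μ : Measure E) [μ.IsAddHaarMeasure] {u : E → F} (hu : ContDiff ℝ 1 u)
    {p q : ℝ≥0} (hp : 1 ≤ p) (hup : MemLp u p μ) (hn : 0 < Module.finrank ℝ E)
    (hq : (q : ℝ)⁻¹ = (p : ℝ)⁻¹ - (Module.finrank ℝ E : ℝ)⁻¹) :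
    eLpNorm u q μ ≤ SNormLESNormFDerivOfEqConst F μ p * eLpNorm (fderiv ℝ u) p μ := by
  let χ : ContDiffBump (0 : E) := ⟨1, 2, one_pos, one_lt_two⟩
  have hχ : ContDiff ℝ 1 χ := χ.contDiff
  obtain ⟨M, hM⟩ := (hχ.continuous_fderiv (by norm_num)).bounded_above_of_compact_support
    (χ.hasCompactSupport.fderiv (𝕜 := ℝ))
  let ε : ℕ → ℝ := fun n => 1 / ((n : ℝ) + 1)
  have hε : ∀ n, 0 < ε n := fun n => by positivity
  have hε0 : Tendsto ε atTop (𝓝 0) := tendsto_one_div_add_atTop_nhds_zero_nat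
  let c : ℕ → E → ℝ := fun n x => χ (ε n • x)
  have hc : ∀ n, ContDiff ℝ 1 (c n) := fun n => hχ.comp (contDiff_const_smul (ε n))
  have hcs : ∀ n, HasCompactSupport (c n) := fun n =>
    χ.hasCompactSupport.comp_smul (hε n).ne'
  have hfd : ∀ n x, ‖fderiv ℝ (c n) x‖ ≤ ε n * M := by
    intro n x
    have h1 : HasFDerivAt (c n) ((fderiv ℝ χ (ε n • x)).comp
        (ε n • ContinuousLinearMap.id ℝ E)) x :=
      ((hχ.differentiable (by norm_num)) _).hasFDerivAt.comp x
        ((ContinuousLinearMap.hasFDerivAt (ε n • ContinuousLinearMap.id ℝ E)))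
    rw [h1.fderiv, ContinuousLinearMap.comp_smul, ContinuousLinearMap.comp_id, norm_smul,
      Real.norm_of_nonneg (hε n).le]
    exact mul_le_mul_of_nonneg_left (hM _) (hε n).le
  have hlim : ∀ x, Tendsto (fun n => c n x • u x) atTop (𝓝 (u x)) := by
    intro x
    have h1 : Tendsto (fun n => ε n • x) atTop (𝓝 0) := by simpa using hε0.smul_const x
    have h2 := (hχ.continuous.tendsto 0).comp h1
    have h3 : χ 0 = 1 := χ.one_of_mem_closedBall (by simp [χ])
    rw [h3] at h2
    simpa using h2.smul_const (u x)
  have hdu : Continuous (fderiv ℝ u) := hu.continuous_fderiv (by norm_num)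
  have hbound : ∀ n, eLpNorm (fun x => c n x • u x) q μ ≤ SNormLESNormFDerivOfEqConst F μ p *
      (eLpNorm (fderiv ℝ u) p μ + ENNReal.ofReal (ε n * M) * eLpNorm u p μ) := by
    intro n
    refine (eLpNorm_le_eLpNorm_fderiv_of_eq μ ((hc n).smul hu) ((hcs n).smul_right)
      hp hn hq).trans ?_
    gcongr
    have hpt : ∀ x, ‖fderiv ℝ (fun x => c n x • u x) x‖ ≤
        ‖(‖fderiv ℝ u x‖ + (ε n * M) * ‖u x‖)‖ := by
      intro x
      rw [fderiv_fun_smul ((hc n).differentiable (by norm_num) x)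
        (hu.differentiable (by norm_num) x)]
      refine (norm_add_le _ _).trans (le_trans ?_ (le_abs_self _))
      rw [norm_smul, ContinuousLinearMap.norm_smulRight_apply]
      have h1 : ‖c n x‖ ≤ 1 := by
        rw [Real.norm_of_nonneg χ.nonneg]; exact χ.le_one
      gcongr
      · exact mul_le_of_le_one_left (norm_nonneg _) h1
      · exact hfd n x
    refine (eLpNorm_mono hpt).trans ?_
    refine (eLpNorm_add_le (f := fun x => ‖fderiv ℝ u x‖)
      (g := fun x => (ε n * M) * ‖u x‖) hdu.norm.aestronglyMeasurable
      (hu.continuous.norm.const_smul (ε n * M)).aestronglyMeasurable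
      (by exact_mod_cast hp)).trans ?_
    rw [eLpNorm_norm]
    gcongr
    refine eLpNorm_le_mul_eLpNorm_of_ae_le_mul (Eventually.of_forall fun x => ?_) p
    rw [norm_mul, norm_norm]
    have : 0 ≤ ε n * M := (norm_nonneg _).trans (hfd n x)
    rw [Real.norm_of_nonneg this]
  refine (Lp.eLpNorm_lim_le_liminf_eLpNorm (f := fun n x => c n x • u x)
    (fun n => ((hc n).continuous.smul hu.continuous).aestronglyMeasurable) u
    (Eventually.of_forall hlim)).trans ?_
  refine (liminf_le_liminf (Eventually.of_forall hbound)).trans_eq (Tendsto.liminf_eq ?_)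
  refine ENNReal.Tendsto.const_mul ?_ (Or.inr ENNReal.coe_ne_top)
  have h1 : Tendsto (fun n => ENNReal.ofReal (ε n * M)) atTop (𝓝 0) := by
    simpa using ENNReal.tendsto_ofReal (hε0.mul_const M)
  simpa using (ENNReal.Tendsto.mul_const h1 (Or.inr hup.eLpNorm_ne_top)).const_add
    (eLpNorm (fderiv ℝ u) p μ)

theorem exists_hasFDerivAt_norm_rpow_of_ne_zero {E : Type*} [NormedAddCommGroup E]
    [InnerProductSpace ℝ E] {x : E} (hx : x ≠ 0) (a : ℝ) :
    ∃ L : E →L[ℝ] ℝ, HasFDerivAt (fun y : E => ‖y‖ ^ a) L x ∧ ‖L‖ ≤ |a| * ‖x‖ ^ (a - 1) := by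
  refine ⟨(a * ‖x‖ ^ (a - 2)) • innerSL ℝ x, ?_, ?_⟩
  · apply HasStrictFDerivAt.hasFDerivAt
    convert! (hasStrictFDerivAt_norm_sq x).rpow_const (p := a / 2) (by simp [hx]) using 0
    simp_rw [← Real.rpow_natCast_mul (norm_nonneg _), ← Nat.cast_smul_eq_nsmul ℝ, smul_smul]
    ring_nf
  · have h0 : 0 < ‖x‖ := norm_pos_iff.mpr hx
    rw [norm_smul, innerSL_apply_norm, norm_mul,
      Real.norm_of_nonneg (by positivity : 0 ≤ ‖x‖ ^ (a - 2)), mul_assoc,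
      ← Real.rpow_add_one h0.ne', Real.norm_eq_abs]
    ring_nf
    rfl

theorem exists_hasFDerivAt_norm_rpow_smul_self {E : Type*} [NormedAddCommGroup E]
    [InnerProductSpace ℝ E] (z : E) {a : ℝ} (ha : 0 < a) :
    ∃ D : E →L[ℝ] E, HasFDerivAt (fun y : E => ‖y‖ ^ a • y) D z ∧
      ‖D‖ ≤ (a + 1) * ‖z‖ ^ a := by
  rcases eq_or_ne z 0 with rfl | hz
  · refine ⟨0, ?_, by simp [Real.zero_rpow ha.ne']⟩
    refine .of_isLittleO ?_
    have h1 : (fun y : E => ‖y‖ ^ a) =o[𝓝 0] (fun _ => (1 : ℝ)) := by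
      refine (Asymptotics.isLittleO_one_iff ℝ).mpr ?_
      have := (continuous_norm (E := E)).rpow_const (fun _ => Or.inr ha.le) |>.tendsto 0
      simpa [Real.zero_rpow ha.ne'] using this
    simpa using h1.smul_isBigO (Asymptotics.isBigO_refl (fun y : E => y) (𝓝 0))
  · obtain ⟨L, hL, hLn⟩ := exists_hasFDerivAt_norm_rpow_of_ne_zero hz a
    refine ⟨_, hL.smul (hasFDerivAt_id z), ?_⟩
    have h0 : 0 < ‖z‖ := norm_pos_iff.mpr hz
    refine (norm_add_le _ _).trans ?_
    rw [norm_smul, ContinuousLinearMap.norm_smulRight_apply,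
      Real.norm_of_nonneg (by positivity)]
    have h1 : ‖L‖ * ‖z‖ ≤ a * ‖z‖ ^ a := by
      calc ‖L‖ * ‖z‖ ≤ |a| * ‖z‖ ^ (a - 1) * ‖z‖ := by gcongr
        _ = a * ‖z‖ ^ a := by
          rw [mul_assoc, ← Real.rpow_add_one h0.ne', abs_of_pos ha]; ring_nf
    have h2 := mul_le_mul_of_nonneg_left (ContinuousLinearMap.norm_id_le (𝕜 := ℝ) (E := E))
      (by positivity : 0 ≤ ‖z‖ ^ a)
    linarith

theorem norm_fderiv_norm_rpow_smul_le {E F : Type*} [NormedAddCommGroup E]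
    [InnerProductSpace ℝ E] [NormedAddCommGroup F] [InnerProductSpace ℝ F]
    {u : E → F} {x : E} (hx : x ≠ 0) (hu : DifferentiableAt ℝ u x) {a b : ℝ} (ha : 0 < a)
    (hb : 0 < b) :
    ‖fderiv ℝ (fun y => ‖y‖ ^ (-b) • ‖u y‖ ^ a • u y) x‖ ≤
      (a + 1 + b) * ((‖x‖⁻¹ * ‖u x‖) ^ b * ‖u x‖ ^ (a - b) *
        (‖fderiv ℝ u x‖ + ‖x‖⁻¹ * ‖u x‖)) := by
  obtain ⟨L, hL, hLn⟩ := exists_hasFDerivAt_norm_rpow_of_ne_zero hx (-b)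
  obtain ⟨D, hD, hDn⟩ := exists_hasFDerivAt_norm_rpow_smul_self (u x) ha
  have h0 : 0 < ‖x‖ := norm_pos_iff.mpr hx
  have hF := hL.smul (hD.comp x hu.hasFDerivAt)
  have hF' : HasFDerivAt (fun y => ‖y‖ ^ (-b) • ‖u y‖ ^ a • u y) _ x := hF
  rw [hF'.fderiv]
  refine (norm_add_le _ _).trans ?_
  rw [norm_smul, ContinuousLinearMap.norm_smulRight_apply,
    Real.norm_of_nonneg (by positivity)]
  have e1 : (‖x‖⁻¹ * ‖u x‖) ^ b * ‖u x‖ ^ (a - b) = ‖x‖ ^ (-b) * ‖u x‖ ^ a := by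
    rw [Real.mul_rpow (by positivity) (by positivity), Real.inv_rpow h0.le,
      Real.rpow_neg h0.le]
    rcases eq_or_lt_of_le (norm_nonneg (u x)) with h | h
    · rw [← h, Real.zero_rpow hb.ne', Real.zero_rpow ha.ne']; simp
    · rw [mul_assoc, ← Real.rpow_add h]; ring_nf
  have e2 : ‖D.comp (fderiv ℝ u x)‖ ≤ (a + 1) * ‖u x‖ ^ a * ‖fderiv ℝ u x‖ :=
    (ContinuousLinearMap.opNorm_comp_le _ _).trans (by gcongr)
  have e3 : ‖L‖ ≤ b * (‖x‖ ^ (-b) * ‖x‖⁻¹) := by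
    rwa [abs_neg, abs_of_pos hb, Real.rpow_sub_one h0.ne', div_eq_mul_inv] at hLn
  have e4 : ‖(‖u x‖ ^ a • u x)‖ = ‖u x‖ ^ a * ‖u x‖ := by
    rw [norm_smul, Real.norm_of_nonneg (by positivity)]
  rw [e1]
  simp only [Function.comp]
  rw [e4]
  calc ‖x‖ ^ (-b) * ‖D.comp (fderiv ℝ u x)‖ + ‖L‖ * (‖u x‖ ^ a * ‖u x‖)
      ≤ ‖x‖ ^ (-b) * ((a + 1) * ‖u x‖ ^ a * ‖fderiv ℝ u x‖)
        + b * (‖x‖ ^ (-b) * ‖x‖⁻¹) * (‖u x‖ ^ a * ‖u x‖) := by gcongr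
    _ = ‖x‖ ^ (-b) * ‖u x‖ ^ a * ((a + 1) * ‖fderiv ℝ u x‖ + b * (‖x‖⁻¹ * ‖u x‖)) := by ring
    _ ≤ ‖x‖ ^ (-b) * ‖u x‖ ^ a * ((a + 1 + b) * ‖fderiv ℝ u x‖
        + (a + 1 + b) * (‖x‖⁻¹ * ‖u x‖)) := by
        refine mul_le_mul_of_nonneg_left (add_le_add ?_ ?_) (by positivity) <;>
          exact mul_le_mul_of_nonneg_right (by linarith) (by positivity)
    _ = _ := by ring
theorem enorm_le_enorm_mul_lintegral_fderiv_smul {E F : Type*} [NormedAddCommGroup E]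
    [NormedSpace ℝ E] [NormedAddCommGroup F] [NormedSpace ℝ F] {u : E → F}
    (hu : ContDiff ℝ 1 u) (hlim : Tendsto u (cocompact E) (𝓝 0)) {x : E} (hx : x ≠ 0) :
    ‖u x‖ₑ ≤ ‖x‖ₑ * ∫⁻ s in Ioi (1 : ℝ), ‖fderiv ℝ u (s • x)‖ₑ := by
  have hφ : ContDiff ℝ 1 (fun s : ℝ => u (s • x)) :=
    hu.comp (contDiff_id.smul contDiff_const)
  have hd : ∀ s : ℝ, ‖deriv (fun s : ℝ => u (s • x)) s‖ₑ ≤ ‖x‖ₑ * ‖fderiv ℝ u (s • x)‖ₑ := by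
    intro s
    have h1 : HasDerivAt (fun s : ℝ => s • x) x s := by
      simpa using (hasDerivAt_id s).smul_const x
    have h2 := ((hu.differentiable (by norm_num)) (s • x)).hasFDerivAt.comp_hasDerivAt s h1
    have h3 : deriv (fun s : ℝ => u (s • x)) s = fderiv ℝ u (s • x) x := h2.deriv
    rw [h3, mul_comm]
    exact ContinuousLinearMap.le_opENorm _ _
  have hS : ∀ S : ℝ, 1 ≤ S → ‖u (S • x) - u x‖ₑ ≤
      ‖x‖ₑ * ∫⁻ s in Ioi (1 : ℝ), ‖fderiv ℝ u (s • x)‖ₑ := by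
    intro S hS
    have h1 := enorm_sub_le_lintegral_deriv_of_contDiffOn_Icc hφ.contDiffOn hS
    simp only [one_smul] at h1
    refine h1.trans ?_
    rw [← restrict_Ioc_eq_restrict_Icc, ← lintegral_const_mul' _ _ enorm_ne_top]
    exact (lintegral_mono hd).trans (lintegral_mono_set Ioc_subset_Ioi_self)
  have ht : Tendsto (fun S : ℝ => S • x) atTop (cocompact E) := by
    refine tendsto_cocompact_of_tendsto_dist_comp_atTop 0 ?_
    simp only [dist_zero_right, norm_smul]
    exact (tendsto_norm_atTop_atTop).atTop_mul_const (norm_pos_iff.mpr hx)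
  have h2 : Tendsto (fun S : ℝ => ‖u (S • x) - u x‖ₑ) atTop (𝓝 ‖u x‖ₑ) := by
    have := ((hlim.comp ht).sub_const (u x)).enorm
    simpa using this
  exact le_of_tendsto h2 ((eventually_ge_atTop 1).mono hS)

/-- Hölder's inequality against a power weight on `(1, ∞)`. -/
theorem exists_lintegral_Ioi_rpow_le {r β : ℝ} (hr : 1 < r) (hβ : r - 1 < β) :
    ∃ K : ℝ≥0∞, K ≠ ∞ ∧ ∀ g : ℝ → ℝ≥0∞, Measurable g →
      (∫⁻ s in Ioi (1 : ℝ), g s) ^ r ≤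
        K * ∫⁻ s in Ioi (1 : ℝ), ENNReal.ofReal (s ^ β) * g s ^ r := by
  have hr0 : 0 < r := by linarith
  have hr1 : 0 < r - 1 := by linarith
  have hconj : (r / (r - 1)).HolderConjugate r := (Real.HolderConjugate.conjExponent hr).symm
  have hq0 : 0 < r / (r - 1) := by positivity
  set J := ∫⁻ s in Ioi (1 : ℝ), ENNReal.ofReal (s ^ (-(β / (r - 1)))) with hJ
  have hJt : J ≠ ∞ := (IntegrableOn.setLIntegral_lt_top
    (integrableOn_Ioi_rpow_of_lt (by rw [neg_lt_neg_iff, one_lt_div hr1]; exact hβ) one_pos)).ne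
  refine ⟨(J ^ (1 / (r / (r - 1)))) ^ r, by finiteness, fun g hg => ?_⟩
  have h := ENNReal.lintegral_mul_le_Lp_mul_Lq (volume.restrict (Ioi (1 : ℝ))) hconj
    (f := fun s => ENNReal.ofReal (s ^ (-(β / r))))
    (g := fun s => ENNReal.ofReal (s ^ (β / r)) * g s)
    (by fun_prop) (by fun_prop)
  have e1 : ∫⁻ s in Ioi (1 : ℝ), ((fun s => ENNReal.ofReal (s ^ (-(β / r)))) *
      (fun s => ENNReal.ofReal (s ^ (β / r)) * g s)) s = ∫⁻ s in Ioi (1 : ℝ), g s := by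
    refine setLIntegral_congr_fun measurableSet_Ioi fun s hs => ?_
    have hs0 : (0 : ℝ) < s := one_pos.trans hs
    simp only [Pi.mul_apply]
    rw [← mul_assoc, ← ENNReal.ofReal_mul (by positivity), ← Real.rpow_add hs0]
    simp
  have e2 : ∫⁻ s in Ioi (1 : ℝ), ENNReal.ofReal (s ^ (-(β / r))) ^ (r / (r - 1)) = J := by
    refine setLIntegral_congr_fun measurableSet_Ioi fun s hs => ?_
    have hs0 : (0 : ℝ) < s := one_pos.trans hs
    rw [ENNReal.ofReal_rpow_of_nonneg (by positivity) hq0.le, ← Real.rpow_mul hs0.le]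
    congr 2
    field_simp
  have e3 : ∫⁻ s in Ioi (1 : ℝ), (ENNReal.ofReal (s ^ (β / r)) * g s) ^ r =
      ∫⁻ s in Ioi (1 : ℝ), ENNReal.ofReal (s ^ β) * g s ^ r := by
    refine setLIntegral_congr_fun measurableSet_Ioi fun s hs => ?_
    have hs0 : (0 : ℝ) < s := one_pos.trans hs
    rw [ENNReal.mul_rpow_of_nonneg _ _ hr0.le,
      ENNReal.ofReal_rpow_of_nonneg (by positivity) hr0.le, ← Real.rpow_mul hs0.le,
      div_mul_cancel₀ _ hr0.ne']
  rw [e1, e2, e3] at h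
  refine (ENNReal.rpow_le_rpow h hr0.le).trans_eq ?_
  rw [ENNReal.mul_rpow_of_nonneg _ _ hr0.le, one_div r, ENNReal.rpow_inv_rpow hr0.ne']

theorem lintegral_comp_smul_addHaar {E : Type*} [NormedAddCommGroup E] [NormedSpace ℝ E]
    [FiniteDimensional ℝ E] [MeasurableSpace E] [BorelSpace E] (μ : Measure E)
    [μ.IsAddHaarMeasure] (f : E → ℝ≥0∞) {s : ℝ} (hs : 0 < s) :
    ∫⁻ x, f (s • x) ∂μ =
      ENNReal.ofReal (s ^ (-(Module.finrank ℝ E : ℝ))) * ∫⁻ x, f x ∂μ := by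
  have h1 : ∫⁻ x, f x ∂(Measure.map (s • ·) μ) = ∫⁻ x, f (s • x) ∂μ :=
    (Homeomorph.smulOfNeZero s hs.ne').measurableEmbedding.lintegral_map f
  rw [← h1, Measure.map_addHaar_smul μ hs.ne', lintegral_smul_measure, smul_eq_mul,
    Real.rpow_neg hs.le, Real.rpow_natCast, abs_of_pos (by positivity)]

/-- **Hardy's inequality** in `Lʳ`, for `1 < r < dim E`. -/
theorem exists_lintegral_inv_norm_smul_rpow_le {E F : Type*} [NormedAddCommGroup E]
    [NormedSpace ℝ E] [FiniteDimensional ℝ E] [MeasurableSpace E] [BorelSpace E]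
    [NormedAddCommGroup F] [NormedSpace ℝ F] (μ : Measure E) [μ.IsAddHaarMeasure]
    {r : ℝ} (hr : 1 < r) (hrn : r < Module.finrank ℝ E) :
    ∃ C : ℝ≥0∞, C ≠ ∞ ∧ ∀ u : E → F, ContDiff ℝ 1 u → Tendsto u (cocompact E) (𝓝 0) →
      ∫⁻ x, ‖‖x‖⁻¹ • u x‖ₑ ^ r ∂μ ≤ C * ∫⁻ x, ‖fderiv ℝ u x‖ₑ ^ r ∂μ := by
  set n : ℝ := (Module.finrank ℝ E : ℝ) with hn
  have hr0 : 0 < r := by linarith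
  set β := (r + n) / 2 - 1 with hβ
  obtain ⟨K, hK, hKle⟩ := exists_lintegral_Ioi_rpow_le hr (β := β) (by linarith)
  set J := ∫⁻ s in Ioi (1 : ℝ), ENNReal.ofReal (s ^ (β - n)) with hJ
  have hJt : J ≠ ∞ := (IntegrableOn.setLIntegral_lt_top
    (integrableOn_Ioi_rpow_of_lt (by linarith) one_pos)).ne
  refine ⟨K * J, by finiteness, fun u hu hlim => ?_⟩
  have hdu : Continuous (fderiv ℝ u) := hu.continuous_fderiv (by norm_num)
  have hmeas : Measurable fun z : E × ℝ =>
      ENNReal.ofReal (z.2 ^ β) * ‖fderiv ℝ u (z.2 • z.1)‖ₑ ^ r := by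
    have h1 : Measurable fun z : E × ℝ => ‖fderiv ℝ u (z.2 • z.1)‖ₑ :=
      (hdu.comp (continuous_snd.smul continuous_fst)).enorm.measurable
    fun_prop
  have hpt : ∀ x, ‖‖x‖⁻¹ • u x‖ₑ ^ r ≤ K * ∫⁻ s in Ioi (1 : ℝ),
      ENNReal.ofReal (s ^ β) * ‖fderiv ℝ u (s • x)‖ₑ ^ r := by
    intro x
    rcases eq_or_ne x 0 with rfl | hx
    · simp [ENNReal.zero_rpow_of_pos hr0]
    · refine le_trans ?_ (hKle (fun s => ‖fderiv ℝ u (s • x)‖ₑ)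
        (hdu.comp (continuous_id.smul continuous_const)).enorm.measurable)
      gcongr
      rw [enorm_smul, enorm_inv (norm_ne_zero_iff.mpr hx), enorm_norm]
      refine ENNReal.inv_mul_le_iff (by simpa using hx) enorm_ne_top |>.mpr ?_
      exact enorm_le_enorm_mul_lintegral_fderiv_smul hu hlim hx
  calc ∫⁻ x, ‖‖x‖⁻¹ • u x‖ₑ ^ r ∂μ
      ≤ ∫⁻ x, (K * ∫⁻ s in Ioi (1 : ℝ),
          ENNReal.ofReal (s ^ β) * ‖fderiv ℝ u (s • x)‖ₑ ^ r) ∂μ := lintegral_mono hpt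
    _ = K * ∫⁻ s in Ioi (1 : ℝ), ∫⁻ x,
          ENNReal.ofReal (s ^ β) * ‖fderiv ℝ u (s • x)‖ₑ ^ r ∂μ := by
        rw [lintegral_const_mul' _ _ hK, lintegral_lintegral_swap hmeas.aemeasurable]
    _ = K * ∫⁻ s in Ioi (1 : ℝ), ENNReal.ofReal (s ^ (β - n)) *
          ∫⁻ x, ‖fderiv ℝ u x‖ₑ ^ r ∂μ := by
        congr 1
        refine setLIntegral_congr_fun measurableSet_Ioi fun s hs => ?_
        have hs0 : (0 : ℝ) < s := one_pos.trans hs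
        rw [lintegral_const_mul' _ _ ENNReal.ofReal_ne_top,
          lintegral_comp_smul_addHaar μ (fun x => ‖fderiv ℝ u x‖ₑ ^ r) hs0, ← mul_assoc,
          ← ENNReal.ofReal_mul (by positivity), ← Real.rpow_add hs0, ← hn, ← sub_eq_add_neg]
    _ = K * J * ∫⁻ x, ‖fderiv ℝ u x‖ₑ ^ r ∂μ := by
        rw [lintegral_mul_const _ (by fun_prop), mul_assoc]

theorem lintegral_mul_mul_rpow_le {α : Type*} [MeasurableSpace α] {μ : Measure α}
    {f g h : α → ℝ≥0∞} (hf : AEMeasurable f μ) (hg : AEMeasurable g μ) (hh : AEMeasurable h μ)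
    {x y z : ℝ} (hx : 0 ≤ x) (hy : 0 ≤ y) (hz : 0 ≤ z) (hxyz : x + y + z = 1) :
    ∫⁻ a, f a ^ x * g a ^ y * h a ^ z ∂μ ≤
      (∫⁻ a, f a ∂μ) ^ x * (∫⁻ a, g a ∂μ) ^ y * (∫⁻ a, h a ∂μ) ^ z := by
  have := ENNReal.lintegral_prod_norm_pow_le (μ := μ) Finset.univ (f := ![f, g, h])
    (p := ![x, y, z]) (by simp [Fin.forall_fin_succ, hf, hg, hh])
    (by simpa [Fin.sum_univ_three] using hxyz) (by simp [Fin.forall_fin_succ, hx, hy, hz])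
  simpa [Fin.prod_univ_three] using this

theorem exists_lintegral_enorm_rpow_le_of_schwartzMap {E F : Type*} [NormedAddCommGroup E]
    [InnerProductSpace ℝ E] [FiniteDimensional ℝ E] [MeasurableSpace E] [BorelSpace E]
    [NormedAddCommGroup F] [NormedSpace ℝ F] [FiniteDimensional ℝ F]
    (μ : Measure E) [μ.IsAddHaarMeasure] {r q : ℝ} (hr : 1 < r) (hq : 0 < q)
    (hn : 0 < Module.finrank ℝ E) (hrq : q⁻¹ = r⁻¹ - (Module.finrank ℝ E : ℝ)⁻¹) :
    ∃ C : ℝ≥0∞, C ≠ ∞ ∧ ∀ u : 𝓢(E, F),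
      ∫⁻ x, ‖u x‖ₑ ^ q ∂μ ≤ C * (∫⁻ x, ‖fderiv ℝ u x‖ₑ ^ r ∂μ) ^ (q / r) := by
  have hr0 : 0 < r := by linarith
  lift r to ℝ≥0 using hr0.le
  lift q to ℝ≥0 using hq.le
  have hr0' : (r : ℝ≥0∞) ≠ 0 := by exact_mod_cast hr0.ne'
  have hq0' : (q : ℝ≥0∞) ≠ 0 := by exact_mod_cast hq.ne'
  refine ⟨(SNormLESNormFDerivOfEqConst F μ r : ℝ≥0∞) ^ (q : ℝ), by finiteness, fun u => ?_⟩
  have h := eLpNorm_le_eLpNorm_fderiv_of_memLp μ (u.smooth 1) (p := r) (q := q)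
    (by exact_mod_cast hr.le) (u.memLp r μ) hn hrq
  rw [eLpNorm_eq_lintegral_rpow_enorm_toReal hq0' ENNReal.coe_ne_top,
    eLpNorm_eq_lintegral_rpow_enorm_toReal hr0' ENNReal.coe_ne_top] at h
  simp only [ENNReal.coe_toReal] at h
  have h2 := ENNReal.rpow_le_rpow h hq.le
  rwa [one_div, ENNReal.rpow_inv_rpow hq.ne', ENNReal.mul_rpow_of_nonneg _ _ hq.le,
    ← ENNReal.rpow_mul, one_div_mul_eq_div] at h2

/-- Gradient estimate at fixed time for the inhomogeneous power nonlinearity. -/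
theorem exists_lintegral_enorm_fderiv_norm_rpow_smul_le {E F : Type*} [NormedAddCommGroup E]
    [InnerProductSpace ℝ E] [FiniteDimensional ℝ E] [MeasurableSpace E] [BorelSpace E]
    [NormedAddCommGroup F] [InnerProductSpace ℝ F] [FiniteDimensional ℝ F]
    (μ : Measure E) [μ.IsAddHaarMeasure] {a b r q s : ℝ} (hb : 0 < b) (hba : b < a)
    (hr : 1 < r) (hq : 0 < q) (hs : 0 < s) (hrn : r < Module.finrank ℝ E)
    (hrq : q⁻¹ = r⁻¹ - (Module.finrank ℝ E : ℝ)⁻¹)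
    (hs_eq : s⁻¹ = b / r + (a - b) / q + 1 / r) :
    ∃ C : ℝ≥0∞, C ≠ ∞ ∧ ∀ u : 𝓢(E, F),
      ∫⁻ x, ‖fderiv ℝ (fun y => ‖y‖ ^ (-b) • ‖u y‖ ^ a • u y) x‖ₑ ^ s ∂μ ≤
        C * (∫⁻ x, ‖fderiv ℝ u x‖ₑ ^ r ∂μ) ^ ((a + 1) * s / r) := by
  have hr0 : 0 < r := by linarith
  have ha : 0 < a := hb.trans hba
  have hn : 0 < Module.finrank ℝ E := by
    have : (0 : ℝ) < Module.finrank ℝ E := hr0.trans hrn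
    exact_mod_cast this
  have : Nontrivial E := Module.finrank_pos_iff.mp hn
  obtain ⟨C₁, hC₁, hardy⟩ :=
    exists_lintegral_inv_norm_smul_rpow_le (F := F) μ hr hrn
  obtain ⟨C₂, hC₂, sobolev⟩ :=
    exists_lintegral_enorm_rpow_le_of_schwartzMap (F := F) μ hr hq hn hrq
  set C₃ : ℝ≥0∞ := 2 ^ (r - 1) * (1 + C₁) with hC₃
  have hC₃t : C₃ ≠ ∞ := by finiteness
  set x := b * s / r with hx
  set y := (a - b) * s / q with hy
  set z := s / r with hz
  have hx0 : 0 ≤ x := by positivity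
  have hy0 : 0 ≤ y := by have := sub_pos.mpr hba; positivity
  have hz0 : 0 ≤ z := by positivity
  have hxyz : x + y + z = 1 := by
    calc x + y + z = s * (b / r + (a - b) / q + 1 / r) := by rw [hx, hy, hz]; ring
      _ = 1 := by rw [← hs_eq, mul_inv_cancel₀ hs.ne']
  refine ⟨ENNReal.ofReal (a + 1 + b) ^ s * (C₁ ^ x * C₂ ^ y * C₃ ^ z), by finiteness,
    fun u => ?_⟩
  set A := ∫⁻ x, ‖fderiv ℝ u x‖ₑ ^ r ∂μ with hA
  have hdu : Continuous (fderiv ℝ u) := (u.smooth 1).continuous_fderiv (by norm_num)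
  set V : E → ℝ≥0∞ := fun x => ‖‖x‖⁻¹ • u x‖ₑ with hV
  set U : E → ℝ≥0∞ := fun x => ‖u x‖ₑ with hU
  set G : E → ℝ≥0∞ := fun x => ‖fderiv ℝ u x‖ₑ with hG
  have hUm : Measurable U := u.continuous.enorm.measurable
  have hGm : Measurable G := hdu.enorm.measurable
  have hVm : Measurable V := by
    have : V = fun x => ‖‖x‖⁻¹‖ₑ * U x := by ext x; simp only [hV, hU, enorm_smul]
    rw [this]; fun_prop
  have hVle : ∫⁻ x, V x ^ r ∂μ ≤ C₁ * A := hardy u (u.smooth 1) u.tendsto_cocompact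
  have hUle : ∫⁻ x, U x ^ q ∂μ ≤ C₂ * A ^ (q / r) := sobolev u
  have hWle : ∫⁻ x, (G x + V x) ^ r ∂μ ≤ C₃ * A := by
    calc ∫⁻ x, (G x + V x) ^ r ∂μ
        ≤ ∫⁻ x, 2 ^ (r - 1) * (G x ^ r + V x ^ r) ∂μ :=
          lintegral_mono fun x => ENNReal.rpow_add_le_mul_rpow_add_rpow _ _ hr.le
      _ = 2 ^ (r - 1) * (A + ∫⁻ x, V x ^ r ∂μ) := by
          rw [lintegral_const_mul' _ _ (by finiteness), lintegral_add_left (by fun_prop)]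
      _ ≤ 2 ^ (r - 1) * (A + C₁ * A) := by gcongr
      _ = C₃ * A := by rw [hC₃]; ring
  have hpt : ∀ᵐ w ∂μ, ‖fderiv ℝ (fun y => ‖y‖ ^ (-b) • ‖u y‖ ^ a • u y) w‖ₑ ^ s ≤
      ENNReal.ofReal (a + 1 + b) ^ s *
        ((V w ^ r) ^ x * (U w ^ q) ^ y * ((G w + V w) ^ r) ^ z) := by
    filter_upwards [compl_mem_ae_iff.mpr (measure_singleton (μ := μ) (0 : E))] with w hw
    have h1 := norm_fderiv_norm_rpow_smul_le hw (u.differentiableAt (x := w)) ha hb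
    have h2 : ‖fderiv ℝ (fun y => ‖y‖ ^ (-b) • ‖u y‖ ^ a • u y) w‖ₑ ≤
        ENNReal.ofReal (a + 1 + b) * (V w ^ b * U w ^ (a - b) * (G w + V w)) := by
      have hVw : V w = ENNReal.ofReal (‖w‖⁻¹ * ‖u w‖) := by
        simp only [hV]
        rw [← ofReal_norm, norm_smul, norm_inv, norm_norm]
      have hUw : U w = ENNReal.ofReal ‖u w‖ := (ofReal_norm _).symm
      have hGw : G w = ENNReal.ofReal ‖fderiv ℝ u w‖ := (ofReal_norm _).symm
      rw [hVw, hUw, hGw, ← ENNReal.ofReal_add (by positivity) (by positivity),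
        ENNReal.ofReal_rpow_of_nonneg (by positivity) hb.le,
        ENNReal.ofReal_rpow_of_nonneg (by positivity) (sub_pos.mpr hba).le,
        ← ENNReal.ofReal_mul (by positivity), ← ENNReal.ofReal_mul (by positivity),
        ← ENNReal.ofReal_mul (by positivity), ← ofReal_norm]
      exact ENNReal.ofReal_le_ofReal h1
    refine (ENNReal.rpow_le_rpow h2 hs.le).trans_eq ?_
    simp only [ENNReal.mul_rpow_of_nonneg _ _ hs.le, ← ENNReal.rpow_mul]
    rw [show r * x = b * s by rw [hx]; field_simp, show q * y = (a - b) * s by rw [hy]; field_simp,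
      show r * z = s by rw [hz]; field_simp]
  calc ∫⁻ w, ‖fderiv ℝ (fun y => ‖y‖ ^ (-b) • ‖u y‖ ^ a • u y) w‖ₑ ^ s ∂μ
      ≤ ENNReal.ofReal (a + 1 + b) ^ s *
          ∫⁻ w, (V w ^ r) ^ x * (U w ^ q) ^ y * ((G w + V w) ^ r) ^ z ∂μ := by
        rw [← lintegral_const_mul' _ _ (by finiteness)]
        exact lintegral_mono_ae hpt
    _ ≤ ENNReal.ofReal (a + 1 + b) ^ s * ((∫⁻ w, V w ^ r ∂μ) ^ x * (∫⁻ w, U w ^ q ∂μ) ^ y *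
          (∫⁻ w, (G w + V w) ^ r ∂μ) ^ z) := by
        gcongr
        exact lintegral_mul_mul_rpow_le (by fun_prop) (by fun_prop) (by fun_prop) hx0 hy0 hz0 hxyz
    _ ≤ ENNReal.ofReal (a + 1 + b) ^ s * ((C₁ * A) ^ x * (C₂ * A ^ (q / r)) ^ y *
          (C₃ * A) ^ z) := by gcongr
    _ = ENNReal.ofReal (a + 1 + b) ^ s * (C₁ ^ x * C₂ ^ y * C₃ ^ z) *
          A ^ ((a + 1) * s / r) := by
        have e : (a + 1) * s / r = x + q / r * y + z := by
          rw [hx, hy, hz]; field_simp; ring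
        rw [e, ENNReal.rpow_add_of_nonneg _ _ (by positivity) hz0,
          ENNReal.rpow_add_of_nonneg _ _ hx0 (by positivity),
          ENNReal.mul_rpow_of_nonneg _ _ hx0, ENNReal.mul_rpow_of_nonneg _ _ hy0,
          ENNReal.mul_rpow_of_nonneg _ _ hz0, ← ENNReal.rpow_mul]
        ring

theorem gradLen_le {N : ℕ} (f : EuclideanSpace ℝ (Fin N) → ℂ)
    (x : EuclideanSpace ℝ (Fin N)) : gradLen f x ≤ Real.sqrt N * ‖fderiv ℝ f x‖ := by
  have h : ∀ i, ‖fderiv ℝ f x (EuclideanSpace.single i 1)‖ ≤ ‖fderiv ℝ f x‖ := fun i => by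
    simpa using (fderiv ℝ f x).le_opNorm (EuclideanSpace.single i 1)
  rw [gradLen]
  refine (Real.sqrt_le_sqrt (y := N * ‖fderiv ℝ f x‖ ^ 2) ?_).trans_eq ?_
  · calc ∑ i, ‖fderiv ℝ f x (EuclideanSpace.single i 1)‖ ^ 2
        ≤ ∑ _i : Fin N, ‖fderiv ℝ f x‖ ^ 2 := by gcongr with i; exact h i
      _ = N * ‖fderiv ℝ f x‖ ^ 2 := by simp
  · rw [Real.sqrt_mul (Nat.cast_nonneg N), Real.sqrt_sq (norm_nonneg _)]

theorem norm_fderiv_le_gradLen {N : ℕ} (f : EuclideanSpace ℝ (Fin N) → ℂ)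
    (x : EuclideanSpace ℝ (Fin N)) : ‖fderiv ℝ f x‖ ≤ gradLen f x := by
  refine ContinuousLinearMap.opNorm_le_bound _ (Real.sqrt_nonneg _) fun v => ?_
  have hv : v = ∑ i, v i • EuclideanSpace.single i (1 : ℝ) := by
    simpa using ((EuclideanSpace.basisFun (Fin N) ℝ).sum_repr v).symm
  calc ‖fderiv ℝ f x v‖ = ‖∑ i, v i • fderiv ℝ f x (EuclideanSpace.single i 1)‖ := by
        conv_lhs => rw [hv]
        simp only [map_sum, map_smul]
    _ ≤ ∑ i, ‖fderiv ℝ f x (EuclideanSpace.single i 1)‖ * ‖v i‖ := by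
        refine (norm_sum_le _ _).trans_eq (Finset.sum_congr rfl fun i _ => ?_)
        rw [norm_smul, mul_comm]
    _ ≤ gradLen f x * ‖v‖ := by
        rw [EuclideanSpace.norm_eq, gradLen]
        exact Real.sum_mul_le_sqrt_mul_sqrt _ _ _

/-- Energy-critical nonlinear estimate: for `N ≥ 3`, `0 < b < 4/N`,
`p = (N+2-2b)/(N-2)`, `σ' = 2N/(N+2)` and `r = 2N(N+2-2b)/(N²-2Nb+4)`, there is
`C > 0`, independent of the interval `I`, such that
`‖∇(|x|^{-b}|u|^{p-1}u)‖_{L²(I;L^{σ'})} ≤ C ‖∇u‖_{L^{2p}(I;L^r)}^p`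
(both sides possibly infinite) for every jointly measurable family of Schwartz
functions `u`. -/
theorem energy_critical_nonlinear_estimate (N : ℕ) (hN : 3 ≤ N)
    (b p σ' r : ℝ) (hb0 : 0 < b) (hb4 : b < 4 / (N : ℝ))
    (hp : p = ((N : ℝ) + 2 - 2 * b) / ((N : ℝ) - 2))
    (hσ : σ' = 2 * (N : ℝ) / ((N : ℝ) + 2))
    (hr : r = 2 * (N : ℝ) * ((N : ℝ) + 2 - 2 * b)
        / ((N : ℝ) ^ 2 - 2 * (N : ℝ) * b + 4)) :
    ∃ C : ℝ, 0 < C ∧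
      ∀ (I : Set ℝ), I.OrdConnected →
        ∀ u : ℝ → SchwartzMap (EuclideanSpace ℝ (Fin N)) ℂ,
          Measurable (fun tx : ℝ × EuclideanSpace ℝ (Fin N) => u tx.1 tx.2) →
          (∫⁻ t in I,
              (∫⁻ x : EuclideanSpace ℝ (Fin N),
                  ENNReal.ofReal
                    (gradLen
                      (fun y => ((‖y‖ ^ (-b) * ‖u t y‖ ^ (p - 1) : ℝ) : ℂ) * u t y) x)
                    ^ σ') ^ (2 / σ')) ^ ((1 : ℝ) / 2)
            ≤ ENNReal.ofReal C
                * (∫⁻ t in I,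
                    (∫⁻ x : EuclideanSpace ℝ (Fin N),
                        ENNReal.ofReal (gradLen (⇑(u t)) x) ^ r) ^ (2 * p / r))
                  ^ ((1 : ℝ) / 2) := by
  have hn3 : (3 : ℝ) ≤ N := by exact_mod_cast hN
  have hn0 : (0 : ℝ) < N := by linarith
  have hn2 : (0 : ℝ) < N - 2 := by linarith
  have hbN : b * N < 4 := (lt_div_iff₀ hn0).mp hb4
  have hb43 : b < 4 / 3 := by nlinarith
  have hden : (0 : ℝ) < (N : ℝ) ^ 2 - 2 * (N : ℝ) * b + 4 := by nlinarith
  have hnum : (0 : ℝ) < (N : ℝ) + 2 - 2 * b := by linarith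
  have hba : b < p - 1 := by
    rw [hp, lt_sub_iff_add_lt, lt_div_iff₀ hn2]; nlinarith
  have hr1 : 1 < r := by rw [hr, one_lt_div hden]; nlinarith
  have hrn : r < N := by
    rw [hr, div_lt_iff₀ hden]
    have : 0 < (N : ℝ) * (((N : ℝ) - 2) * (N - 2 * b)) :=
      mul_pos hn0 (mul_pos hn2 (by linarith))
    nlinarith
  have hr0 : 0 < r := by linarith
  have hp0 : 0 < p := by linarith
  have hs0 : 0 < σ' := by rw [hσ]; positivity
  set q : ℝ := (r⁻¹ - (N : ℝ)⁻¹)⁻¹ with hq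
  have hq0 : 0 < q := inv_pos.mpr (sub_pos.mpr (inv_strictAnti₀ hr0 hrn))
  have hrq : q⁻¹ = r⁻¹ - (N : ℝ)⁻¹ := by rw [hq, inv_inv]
  have hs_eq : σ'⁻¹ = b / r + (p - 1 - b) / q + 1 / r := by
    have e : b / r + (p - 1 - b) / q + 1 / r = p * r⁻¹ - (p - 1 - b) * (N : ℝ)⁻¹ := by
      rw [div_eq_mul_inv _ q, hrq]; ring
    rw [e, hσ, hr, hp]
    field_simp
    ring
  obtain ⟨K, hK, key⟩ := exists_lintegral_enorm_fderiv_norm_rpow_smul_le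
    (E := EuclideanSpace ℝ (Fin N)) (F := ℂ) volume hb0 hba hr1 hq0 hs0
    (by simpa using hrn) (by simpa using hrq) hs_eq
  set M : ℝ≥0∞ := (ENNReal.ofReal (Real.sqrt N) ^ σ' * K) ^ (2 / σ') with hM
  have h2s : 0 ≤ 2 / σ' := by positivity
  have hMt : M ≠ ∞ := by finiteness
  refine ⟨(M ^ ((1 : ℝ) / 2)).toReal + 1, by positivity, fun I _ u _ => ?_⟩
  have hCle : M ^ ((1 : ℝ) / 2) ≤ ENNReal.ofReal ((M ^ ((1 : ℝ) / 2)).toReal + 1) := by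
    rw [ENNReal.le_ofReal_iff_toReal_le (by finiteness) (by positivity)]
    linarith
  refine le_trans ?_ (mul_le_mul_left hCle _)
  rw [← ENNReal.mul_rpow_of_nonneg _ _ (by norm_num), ← lintegral_const_mul' _ _ hMt]
  refine ENNReal.rpow_le_rpow (lintegral_mono fun t => ?_) (by norm_num)
  set f : EuclideanSpace ℝ (Fin N) → ℂ :=
    fun y => ((‖y‖ ^ (-b) * ‖u t y‖ ^ (p - 1) : ℝ) : ℂ) * u t y with hf
  have hf' : f = fun y => ‖y‖ ^ (-b) • ‖u t y‖ ^ (p - 1) • u t y := by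
    ext y; simp only [hf, Complex.real_smul, Complex.ofReal_mul, mul_assoc]
  have h1 : ∫⁻ x, ENNReal.ofReal (gradLen f x) ^ σ' ≤ ENNReal.ofReal (Real.sqrt N) ^ σ' * K *
      (∫⁻ x, ENNReal.ofReal (gradLen (u t) x) ^ r) ^ (p * σ' / r) := by
    calc ∫⁻ x, ENNReal.ofReal (gradLen f x) ^ σ'
        ≤ ∫⁻ x, ENNReal.ofReal (Real.sqrt N) ^ σ' * ‖fderiv ℝ f x‖ₑ ^ σ' := by
          refine lintegral_mono fun x => ?_
          rw [← ENNReal.mul_rpow_of_nonneg _ _ hs0.le, ← ofReal_norm,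
            ← ENNReal.ofReal_mul (Real.sqrt_nonneg _)]
          exact ENNReal.rpow_le_rpow (ENNReal.ofReal_le_ofReal (gradLen_le f x)) hs0.le
      _ = ENNReal.ofReal (Real.sqrt N) ^ σ' * ∫⁻ x, ‖fderiv ℝ f x‖ₑ ^ σ' :=
          lintegral_const_mul' _ _ (by finiteness)
      _ ≤ ENNReal.ofReal (Real.sqrt N) ^ σ' *
            (K * (∫⁻ x, ‖fderiv ℝ (u t) x‖ₑ ^ r) ^ (p * σ' / r)) := by
          have := key (u t)
          rw [sub_add_cancel, ← hf'] at this
          gcongr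
      _ ≤ ENNReal.ofReal (Real.sqrt N) ^ σ' * (K *
            (∫⁻ x, ENNReal.ofReal (gradLen (u t) x) ^ r) ^ (p * σ' / r)) := by
          gcongr with x
          rw [← ofReal_norm]
          exact ENNReal.ofReal_le_ofReal (norm_fderiv_le_gradLen _ _)
      _ = _ := by rw [mul_assoc]
  refine (ENNReal.rpow_le_rpow h1 h2s).trans_eq ?_
  rw [ENNReal.mul_rpow_of_nonneg _ _ h2s, ← ENNReal.rpow_mul]
  congr 2
  field_simp
end
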